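/- arXiv:2210.07567 — 3 statements merged into one kernel-verified Lean document; each statement's English description precedes it below -/
import Mathlib

section
/- Let P = P(d) be the natural unit interval order on {1,…,n} of a Dyck path d with bounce number 3, and let 0 ≤ l ≤ min{a,b,c}. Then there exists an injective map α from the set of P-tableaux of shape 3^l 2^1 1^{n-3l-2} into the disjoint union of the set of P-tableaux of shape 3^l 1^{n-3l} and the set of P-tableaux of shape 3^{l+1} 1^{n-3l-3}, such that inv(α(T)) = inv(T) for every T in the domain. -/
open scoped Classical

/-- A Dyck path on an `n × n` board: a weakly increasing sequence
`d 1 ≤ d 2 ≤ ⋯ ≤ d (n-1) ≤ n` with `i ≤ d i`; we record it on indices `1, …, n`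
with the harmless boundary convention `d n = n`. -/
structure DyckPath (n : ℕ) where
  d : ℕ → ℕ
  mono : ∀ i j : ℕ, 1 ≤ i → i ≤ j → j ≤ n → d i ≤ d j
  le_n : ∀ i : ℕ, 1 ≤ i → i ≤ n → d i ≤ n
  ge_self : ∀ i : ℕ, 1 ≤ i → i ≤ n → i ≤ d i
  top : d n = n

/-- The shape `3^l 2^j 1^m`, as a list of row lengths. -/
def shape (l j m : ℕ) : List ℕ :=
  List.replicate l 3 ++ List.replicate j 2 ++ List.replicate m 1

/-- Position in the row-by-row reading word where row `i` (0-indexed) starts. -/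
def rowStart (μ : List ℕ) (i : ℕ) : ℕ := (μ.take i).sum

/-- The entry in row `i`, column `j` (both 0-indexed) of the tableau of shape `μ`
whose row-by-row reading word is `L`. -/
def entry (μ L : List ℕ) (i j : ℕ) : ℕ := L.getD (rowStart μ i + j) 0

/-- The cells (row, column), 0-indexed, of the Young diagram with row lengths `μ`. -/
def cellsOf (μ : List ℕ) : Finset (ℕ × ℕ) :=
  (Finset.range μ.length ×ˢ Finset.range (μ.foldr max 0)).filter fun c =>
    c.2 < μ.getD c.1 0

namespace DyckPath

variable {n : ℕ}

/-- The natural unit interval order `P(d)`: `i ≺ j ↔ i < n ∧ j > d i`. -/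
def prec (D : DyckPath n) (i j : ℕ) : Prop := i < n ∧ D.d i < j

/-- Incomparability in `P(d)`. -/
def Incomp (D : DyckPath n) (x y : ℕ) : Prop := ¬ D.prec x y ∧ ¬ D.prec y x

/-- The bounce sequence `m 0 = d 1`, `m (k+1) = d (m k + 1)`. -/
def bounce (D : DyckPath n) : ℕ → ℕ
  | 0 => D.d 1
  | k + 1 => D.d (D.bounce k + 1)

def m0 (D : DyckPath n) : ℕ := D.bounce 0

def m1 (D : DyckPath n) : ℕ := D.bounce 1

/-- `d` has bounce number three: `m 2 = n` is the first bounce term equal to `n`. -/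
def BounceThree (D : DyckPath n) : Prop := D.m0 < n ∧ D.m1 < n ∧ D.bounce 2 = n

/-- `L` is the row-by-row reading word of a `P`-tableau of shape `μ`:
`L` uses each of `1, …, n` exactly once, rows strictly increase in `≺`, and for
vertically adjacent cells the lower entry is not `≺` the upper one. -/
def IsPTab (D : DyckPath n) (μ L : List ℕ) : Prop :=
  L.Perm (List.map (· + 1) (List.range n)) ∧ μ.sum = n ∧
  (∀ i j : ℕ, i < μ.length → j + 1 < μ.getD i 0 →
    D.prec (entry μ L i j) (entry μ L i (j + 1))) ∧
  (∀ i j : ℕ, i + 1 < μ.length → j < μ.getD (i + 1) 0 →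
    ¬ D.prec (entry μ L (i + 1) j) (entry μ L i j))

/-- The number of inversions of a `P`-tableau: pairs of entries `x > y`,
incomparable in `P`, with `x` in a strictly higher row than `y`. -/
noncomputable def invNum (D : DyckPath n) (μ L : List ℕ) : ℕ :=
  ((cellsOf μ ×ˢ cellsOf μ).filter fun pq =>
    pq.1.1 < pq.2.1 ∧ entry μ L pq.2.1 pq.2.2 < entry μ L pq.1.1 pq.1.2 ∧
      D.Incomp (entry μ L pq.1.1 pq.1.2) (entry μ L pq.2.1 pq.2.2)).card

/-- The finite set of (reading words of) `P`-tableaux of shape `μ`. -/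
noncomputable def ptabs (D : DyckPath n) (μ : List ℕ) : Finset (List ℕ) :=
  ((List.map (· + 1) (List.range n)).permutations.toFinset).filter fun L => D.IsPTab μ L

/-- `B_μ(q) = Σ_T q^{inv T}` over all `P`-tableaux `T` of shape `μ`, as a polynomial in `ℤ[q]`. -/
noncomputable def B (D : DyckPath n) (μ : List ℕ) : Polynomial ℤ :=
  ∑ L ∈ D.ptabs μ, Polynomial.X ^ D.invNum μ L

end DyckPath

theorem entry_cons_zero (k : ℕ) (μ L : List ℕ) (j : ℕ) : entry (k :: μ) L 0 j = L.getD j 0 := by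
  simp [entry, rowStart]

theorem entry_cons_succ (k : ℕ) (μ L : List ℕ) (i j : ℕ) :
    entry (k :: μ) L (i + 1) j = entry μ (L.drop k) i j := by
  simp [entry, rowStart, List.getD_eq_getElem?_getD, List.getElem?_drop, add_assoc]

theorem getD_le_foldr_max (μ : List ℕ) (i : ℕ) : μ.getD i 0 ≤ μ.foldr max 0 := by
  induction μ generalizing i with
  | nil => simp
  | cons k μ ih =>
    cases i with
    | zero => simp
    | succ i => simpa using Or.inr (ih i)

theorem mem_cellsOf {μ : List ℕ} {c : ℕ × ℕ} :
    c ∈ cellsOf μ ↔ c.1 < μ.length ∧ c.2 < μ.getD c.1 0 := by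
  have := getD_le_foldr_max μ c.1
  simp only [cellsOf, Finset.mem_filter, Finset.mem_product, Finset.mem_range]
  constructor
  · rintro ⟨⟨h1, -⟩, h2⟩
    exact ⟨h1, h2⟩
  · rintro ⟨h1, h2⟩
    exact ⟨⟨h1, by omega⟩, h2⟩

theorem rowStart_succ (μ : List ℕ) (i : ℕ) : rowStart μ (i + 1) = rowStart μ i + μ.getD i 0 := by
  induction μ generalizing i with
  | nil => simp [rowStart]
  | cons k μ ih =>
    cases i with
    | zero => simp [rowStart]
    | succ i =>
      have := ih i
      simp only [rowStart, List.take_succ_cons, List.sum_cons, List.getD_cons_succ] at this ⊢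
      omega

theorem rowStart_mono (μ : List ℕ) : Monotone (rowStart μ) :=
  monotone_nat_of_le_succ fun i => by rw [rowStart_succ]; omega

theorem rowStart_le_sum (μ : List ℕ) (i : ℕ) : rowStart μ i ≤ μ.sum := by
  have h := rowStart_mono μ (le_max_left i μ.length)
  simpa [rowStart, List.take_of_length_le (le_max_right i μ.length)] using h

theorem exists_cell_of_lt_sum (μ : List ℕ) (p : ℕ) (hp : p < μ.sum) :
    ∃ c ∈ cellsOf μ, rowStart μ c.1 + c.2 = p := by
  induction μ generalizing p with
  | nil => simp at hp
  | cons k μ ih =>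
    by_cases h : p < k
    · exact ⟨(0, p), by simp [mem_cellsOf, h], by simp [rowStart]⟩
    · obtain ⟨c, hc, hcp⟩ := ih (p - k) (by simp at hp; omega)
      refine ⟨(c.1 + 1, c.2), by simpa [mem_cellsOf] using mem_cellsOf.1 hc, ?_⟩
      simp only [rowStart, List.take_succ_cons, List.sum_cons] at hcp ⊢
      omega

theorem cell_position_lt {μ : List ℕ} {c e : ℕ × ℕ} (hc : c ∈ cellsOf μ) (h : c.1 < e.1) :
    rowStart μ c.1 + c.2 < rowStart μ e.1 + e.2 := by
  have h1 := rowStart_mono μ (Nat.succ_le_of_lt h)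
  have h2 := rowStart_succ μ c.1
  have h3 := (mem_cellsOf.1 hc).2
  simp only [Nat.succ_eq_add_one] at h1
  omega

theorem cell_position_injOn {μ : List ℕ} {c e : ℕ × ℕ} (hc : c ∈ cellsOf μ) (he : e ∈ cellsOf μ)
    (h : rowStart μ c.1 + c.2 = rowStart μ e.1 + e.2) : c = e := by
  rcases lt_trichotomy c.1 e.1 with h' | h' | h'
  · have := cell_position_lt hc h'
    omega
  · rw [h'] at h
    exact Prod.ext h' (by omega)
  · have := cell_position_lt he h'
    omega

/-- The number of pairs of entries `u`, `v` of `L` with `u` before `v` and `K u v`. -/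
noncomputable def pairCount (K : ℕ → ℕ → Prop) : List ℕ → ℕ
  | [] => 0
  | a :: t => t.countP (fun b => decide (K a b)) + pairCount K t

theorem countP_eq_sum_range (Q : ℕ → Prop) (L : List ℕ) :
    L.countP (fun b => decide (Q b)) =
      ∑ q ∈ Finset.range L.length, if Q (L.getD q 0) then 1 else 0 := by
  induction L with
  | nil => simp
  | cons a t ih =>
    rw [List.length_cons, Finset.sum_range_succ', List.countP_cons, ih]
    simp

theorem pairCount_eq_card (K : ℕ → ℕ → Prop) (L : List ℕ) :
    pairCount K L = ((Finset.range L.length ×ˢ Finset.range L.length).filter fun pq =>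
      pq.1 < pq.2 ∧ K (L.getD pq.1 0) (L.getD pq.2 0)).card := by
  rw [Finset.card_filter, Finset.sum_product]
  induction L with
  | nil => simp [pairCount]
  | cons a t ih =>
    rw [pairCount, List.length_cons, Finset.sum_range_succ', ih, countP_eq_sum_range, add_comm]
    congr 1
    · refine Finset.sum_congr rfl fun p _ => ?_
      rw [Finset.sum_range_succ']
      simp
    · rw [Finset.sum_range_succ']
      simp

theorem pairCount_append_congr (K : ℕ → ℕ → Prop) (A : List ℕ) {B C : List ℕ} (hp : B.Perm C)
    (h : pairCount K B = pairCount K C) : pairCount K (A ++ B) = pairCount K (A ++ C) := by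
  induction A with
  | nil => simpa
  | cons a A ih =>
    simp only [List.cons_append, pairCount, ih]
    rw [(hp.append_left A).countP_eq]

/-- The conditions on rows and columns of a tableau with reading word `L`, row by row. -/
def RowwiseTab (r : ℕ → ℕ → Prop) : List ℕ → List ℕ → Prop
  | [], _ => True
  | k :: μ, L => (∀ j, j + 1 < k → r (L.getD j 0) (L.getD (j + 1) 0)) ∧
      (∀ j < μ.headD 0, ¬ r (L.getD (k + j) 0) (L.getD j 0)) ∧ RowwiseTab r μ (L.drop k)

theorem rowwiseTab_iff (r : ℕ → ℕ → Prop) (μ L : List ℕ) :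
    RowwiseTab r μ L ↔
      (∀ i j : ℕ, i < μ.length → j + 1 < μ.getD i 0 →
        r (entry μ L i j) (entry μ L i (j + 1))) ∧
      (∀ i j : ℕ, i + 1 < μ.length → j < μ.getD (i + 1) 0 →
        ¬ r (entry μ L (i + 1) j) (entry μ L i j)) := by
  induction μ generalizing L with
  | nil => simp [RowwiseTab]
  | cons k μ ih =>
    rw [RowwiseTab, ih]
    constructor
    · rintro ⟨h1, h2, h3, h4⟩
      constructor
      · rintro (_ | i) j hi hj
        · simpa [entry_cons_zero] using h1 j (by simpa using hj)
        · simpa [entry_cons_succ] using h3 i j (by simpa using hi) (by simpa using hj)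
      · rintro (_ | i) j hi hj
        · rw [entry_cons_zero, entry_cons_succ]
          cases μ with
          | nil => simp at hi
          | cons k' μ =>
            rw [entry_cons_zero]
            simpa [List.getD_eq_getElem?_getD] using h2 j (by simpa using hj)
        · rw [entry_cons_succ, entry_cons_succ]
          exact h4 i j (by simpa using hi) (by simpa using hj)
    · rintro ⟨h1, h2⟩
      refine ⟨fun j hj => ?_, fun j hj => ?_, fun i j hi hj => ?_, fun i j hi hj => ?_⟩
      · simpa [entry_cons_zero] using h1 0 j (by simp) (by simpa using hj)
      · cases μ with
        | nil => simp at hj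
        | cons k' μ =>
          have := h2 0 j (by simp) (by simpa using hj)
          rw [entry_cons_zero, entry_cons_succ, entry_cons_zero] at this
          simpa [List.getD_eq_getElem?_getD] using this
      · simpa [entry_cons_succ] using h1 (i + 1) j (by simpa using hi) (by simpa using hj)
      · have := h2 (i + 1) j (by simpa using hi) (by simpa using hj)
        rwa [entry_cons_succ, entry_cons_succ] at this

theorem rowwiseTab_replicate_one (r : ℕ → ℕ → Prop) (L : List ℕ) :
    RowwiseTab r (List.replicate L.length 1) L ↔ L.IsChain fun u v => ¬ r v u := by
  induction L with
  | nil => simp [RowwiseTab]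
  | cons a t ih =>
    rw [List.length_cons, List.replicate_succ, RowwiseTab, List.drop_one, List.tail_cons, ih]
    cases t with
    | nil => simp
    | cons b t => simp [List.replicate_succ, add_comm 1]

theorem rowwiseTab_cons_replicate_one (r : ℕ → ℕ → Prop) (x : ℕ) (R Z : List ℕ) :
    RowwiseTab r ((R.length + 1) :: List.replicate Z.length 1) (x :: R ++ Z) ↔
      (x :: R).IsChain r ∧ (x :: Z).IsChain fun u v => ¬ r v u := by
  have hrow : (∀ j, j + 1 < R.length + 1 →
      r ((x :: R ++ Z).getD j 0) ((x :: R ++ Z).getD (j + 1) 0)) ↔ (x :: R).IsChain r := by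
    rw [List.isChain_iff_getElem]
    refine forall_congr' fun j => forall_congr' fun hj => ?_
    rw [List.getD_append _ _ _ _ (by simp; omega), List.getD_append _ _ _ _ (by simpa using hj),
      List.getD_eq_getElem _ _ (by simp; omega), List.getD_eq_getElem _ _ (by simpa using hj)]
  have hdrop : (x :: R ++ Z).drop (R.length + 1) = Z := by simp
  rw [RowwiseTab, hrow, hdrop, rowwiseTab_replicate_one]
  cases Z with
  | nil => simp
  | cons z Z =>
    simp [List.replicate_succ, List.getD_eq_getElem?_getD]

theorem RowwiseTab.of_replicate_append {r : ℕ → ℕ → Prop} {l : ℕ} {μ A B : List ℕ}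
    (hA : A.length = 3 * l) (h : RowwiseTab r (List.replicate l 3 ++ μ) (A ++ B)) :
    RowwiseTab r μ B := by
  induction l generalizing A with
  | zero =>
    obtain rfl : A = [] := by simpa using hA
    simpa using h
  | succ l ih =>
    obtain _ | ⟨a, _ | ⟨b, _ | ⟨c, A⟩⟩⟩ := A <;> simp at hA <;> try omega
    rw [List.replicate_succ, List.cons_append, RowwiseTab] at h
    exact ih (A := A) (by omega) (by simpa using h.2.2)

theorem RowwiseTab.replace_tail {r : ℕ → ℕ → Prop} {l : ℕ} {μ ν A B C : List ℕ}
    (hA : A.length = 3 * l) (h : RowwiseTab r (List.replicate l 3 ++ μ) (A ++ B))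
    (hC : RowwiseTab r ν C)
    (hBC : ∀ j < ν.headD 0, j < 3 ∧ ((j < μ.headD 0 ∧ C.getD j 0 = B.getD j 0) ∨
      ∀ u ∈ A, ¬ r (C.getD j 0) u)) :
    RowwiseTab r (List.replicate l 3 ++ ν) (A ++ C) := by
  induction l generalizing A with
  | zero =>
    obtain rfl : A = [] := by simpa using hA
    simpa using hC
  | succ l ih =>
    obtain _ | ⟨a, _ | ⟨b, _ | ⟨c, A⟩⟩⟩ := A <;> simp at hA <;> try omega
    rw [List.replicate_succ, List.cons_append, RowwiseTab] at h ⊢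
    obtain ⟨h1, h2, h3⟩ := h
    refine ⟨fun j hj => ?_, fun j hj => ?_, ?_⟩
    · have := h1 j hj
      obtain rfl | rfl : j = 0 ∨ j = 1 := by omega
      · simpa using this
      · simpa using this
    · cases l with
      | zero =>
        obtain rfl : A = [] := by simpa using hA
        have hj' : j < ν.headD 0 := by simpa using hj
        obtain ⟨hj3, ⟨hjm, e⟩ | hu⟩ := hBC j hj'
        · have := h2 j (by simpa using hjm)
          rw [add_comm 3 j] at this ⊢
          simp only [List.cons_append, List.nil_append, List.getD_cons_succ] at this ⊢
          rw [e]
          interval_cases j <;> simpa using this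
        · rw [add_comm 3 j]
          simp only [List.cons_append, List.nil_append, List.getD_cons_succ]
          apply hu
          interval_cases j <;> simp
      | succ l =>
        have hj' : j < 3 := by simpa [List.replicate_succ] using hj
        obtain _ | ⟨a', _ | ⟨b', _ | ⟨c', A⟩⟩⟩ := A <;> simp at hA <;> try omega
        have := h2 j (by simpa [List.replicate_succ] using hj')
        interval_cases j <;> simpa using this
    · refine ih (by omega) (by simpa using h3) fun j hj => ?_
      obtain ⟨hj3, h | hu⟩ := hBC j hj
      · exact ⟨hj3, Or.inl h⟩
      · exact ⟨hj3, Or.inr fun u hu' => hu u (by simp [hu'])⟩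

/-- A map whose fibres have at most two elements, the larger element of a two-element fibre being
rerouted to a second target that remembers the fibre, gives an injection into the disjoint union. -/
theorem exists_injective_sum_of_fibers {T S U : Type*} (f : T → S) (lt : T → T → Prop)
    (Rel : S → U → Prop) (iT : T → ℕ) (iS : S → ℕ) (iU : U → ℕ)
    (hf : ∀ a, iS (f a) = iT a)
    (htri : ∀ a b, f a = f b → a ≠ b → lt a b ∨ lt b a)
    (hno : ∀ a b c, f a = f b → f b = f c → lt a b → lt b c → False)
    (hU : ∀ a b, f a = f b → lt a b → ∃ u, Rel (f b) u ∧ iU u = iT b)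
    (hRel : ∀ s s' u, Rel s u → Rel s' u → s = s') :
    ∃ α : T → S ⊕ U, Function.Injective α ∧ ∀ t, Sum.elim iS iU (α t) = iT t := by
  have key : ∀ b, ∃ v : S ⊕ U,
      ((v = Sum.inl (f b) ∧ ∀ a, f a = f b → ¬ lt a b) ∨
        ∃ a u, v = Sum.inr u ∧ f a = f b ∧ lt a b ∧ Rel (f b) u) ∧ Sum.elim iS iU v = iT b := by
    intro b
    by_cases h : ∃ a, f a = f b ∧ lt a b
    · obtain ⟨a, hab, hlt⟩ := h
      obtain ⟨u, hu, hi⟩ := hU a b hab hlt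
      exact ⟨Sum.inr u, Or.inr ⟨a, u, rfl, hab, hlt, hu⟩, hi⟩
    · push Not at h
      exact ⟨Sum.inl (f b), Or.inl ⟨rfl, h⟩, hf b⟩
  choose α hα hi using key
  refine ⟨α, fun b c hbc => ?_, hi⟩
  by_contra hne
  rcases hα b with ⟨hb, hb'⟩ | ⟨a, u, hb, hab, hlt, hu⟩ <;>
  rcases hα c with ⟨hc, hc'⟩ | ⟨a', u', hc, hac, hlt', hu'⟩
  · rw [hb, hc] at hbc
    have e := Sum.inl.inj hbc
    rcases htri b c e hne with h | h
    · exact hc' b e h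
    · exact hb' c e.symm h
  · rw [hb, hc] at hbc
    simp at hbc
  · rw [hb, hc] at hbc
    simp at hbc
  · rw [hb, hc] at hbc
    obtain rfl := Sum.inr.inj hbc
    have e := hRel _ _ _ hu hu'
    rcases htri b c e hne with h | h
    · exact hno a b c hab e hlt h
    · exact hno a' c b hac e.symm hlt' h

namespace DyckPath

variable {n : ℕ}

theorem prec_trans (D : DyckPath n) {i j k : ℕ} (h1 : D.prec i j) (h2 : D.prec j k) :
    D.prec i k := by
  refine ⟨h1.1, ?_⟩
  have := D.ge_self j (by have := h1.2; omega) h2.1.le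
  have := h1.2
  have := h2.2
  omega

theorem prec_irrefl (D : DyckPath n) (i : ℕ) : ¬ D.prec i i := fun h => by
  have := D.ge_self i (by have := h.2; omega) h.1.le
  have := h.2
  omega

theorem BounceThree.no_chain_four {D : DyckPath n} (h3 : D.BounceThree) {p q r s : ℕ}
    (hp : 1 ≤ p) (hs : s ≤ n) (h1 : D.prec p q) (h2 : D.prec q r) : ¬ D.prec r s := by
  rintro ⟨h4, h5⟩
  obtain ⟨ha, hb, hc⟩ := h3
  obtain ⟨hp', hq⟩ := h1
  obtain ⟨hq', hr⟩ := h2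
  simp only [m0, m1, bounce] at ha hb hc
  have e1 := D.mono 1 p le_rfl hp hp'.le
  have e2 := D.mono (D.d 1 + 1) q (by omega) (by omega) hq'.le
  have e3 := D.mono (D.d (D.d 1 + 1) + 1) r (by omega) (by omega) h4.le
  omega

theorem IsPTab.rowwiseTab {D : DyckPath n} {μ L : List ℕ} (h : D.IsPTab μ L) :
    RowwiseTab D.prec μ L :=
  (rowwiseTab_iff _ _ _).2 h.2.2

theorem IsPTab.length_eq {D : DyckPath n} {μ L : List ℕ} (h : D.IsPTab μ L) : L.length = n := by
  simpa using h.1.length_eq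

theorem IsPTab.mem_bounds {D : DyckPath n} {μ L : List ℕ} (h : D.IsPTab μ L) {x : ℕ}
    (hx : x ∈ L) : 1 ≤ x ∧ x ≤ n := by
  have := h.1.mem_iff.1 hx
  simp only [List.mem_map, List.mem_range] at this
  omega

theorem IsPTab.prec_of_lt {D : DyckPath n} {μ L : List ℕ} (h : D.IsPTab μ L) {i j k : ℕ}
    (hi : i < μ.length) (hjk : j < k) (hk : k < μ.getD i 0) :
    D.prec (entry μ L i j) (entry μ L i k) := by
  induction k, hjk using Nat.le_induction with
  | base => exact h.2.2.1 i j hi hk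
  | succ k hjk ih => exact D.prec_trans (ih (by omega)) (h.2.2.1 i k hi hk)

/-- The relation counted by inversions: incomparable and decreasing. -/
def Inverted (D : DyckPath n) (x y : ℕ) : Prop := y < x ∧ D.Incomp x y

/-- Entries in a row of a `P`-tableau are pairwise comparable, so inversions can be counted in the
reading word. -/
theorem IsPTab.invNum_eq {D : DyckPath n} {μ L : List ℕ} (h : D.IsPTab μ L) :
    D.invNum μ L = pairCount D.Inverted L := by
  rw [pairCount_eq_card, invNum]
  have hlen : L.length = μ.sum := h.length_eq.trans h.2.1.symm
  refine Finset.card_bij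
    (fun pq _ => (rowStart μ pq.1.1 + pq.1.2, rowStart μ pq.2.1 + pq.2.2)) ?_ ?_ ?_
  · rintro ⟨c, e⟩ hce
    simp only [Finset.mem_filter, Finset.mem_product] at hce
    obtain ⟨⟨hc, he⟩, hlt, hv⟩ := hce
    have h1 := cell_position_lt hc hlt
    have h2 := (mem_cellsOf.1 he).2
    have h3 := rowStart_succ μ e.1
    have h4 := rowStart_le_sum μ (e.1 + 1)
    simp only [Finset.mem_filter, Finset.mem_product, Finset.mem_range]
    exact ⟨⟨by omega, by omega⟩, h1, hv⟩
  · rintro ⟨c, e⟩ hce ⟨c', e'⟩ hce' heq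
    simp only [Finset.mem_filter, Finset.mem_product] at hce hce'
    simp only [Prod.mk.injEq] at heq
    rw [cell_position_injOn hce.1.1 hce'.1.1 heq.1, cell_position_injOn hce.1.2 hce'.1.2 heq.2]
  · rintro ⟨p, q⟩ hpq
    simp only [Finset.mem_filter, Finset.mem_product, Finset.mem_range] at hpq
    obtain ⟨⟨hp, hq⟩, hlt, hv⟩ := hpq
    obtain ⟨c, hc, rfl⟩ := exists_cell_of_lt_sum μ p (by omega)
    obtain ⟨e, he, rfl⟩ := exists_cell_of_lt_sum μ q (by omega)
    refine ⟨(c, e), ?_, rfl⟩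
    simp only [Finset.mem_filter, Finset.mem_product]
    refine ⟨⟨hc, he⟩, ?_, hv⟩
    rcases lt_trichotomy c.1 e.1 with h' | h' | h'
    · exact h'
    · have := h.prec_of_lt (j := c.2) (k := e.2) (mem_cellsOf.1 he).1 (by rw [h'] at hlt; omega)
        (mem_cellsOf.1 he).2
      rw [← h'] at this
      refine absurd ?_ hv.2.1
      simpa [entry, h'] using this
    · have := cell_position_lt he h'
      omega

/-- Insert `y` into `Z` right after the longest prefix of entries below `y`. -/
noncomputable def insertAbove (D : DyckPath n) (y : ℕ) (Z : List ℕ) : List ℕ :=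
  Z.orderedInsert (fun a b => ¬ D.prec b a) y

theorem insertAbove_nil (D : DyckPath n) (y : ℕ) : D.insertAbove y [] = [y] := rfl

theorem insertAbove_cons_of_prec (D : DyckPath n) {y z : ℕ} (Z : List ℕ) (h : D.prec z y) :
    D.insertAbove y (z :: Z) = z :: D.insertAbove y Z := by
  simp [insertAbove, h]

theorem insertAbove_cons_of_not_prec (D : DyckPath n) {y z : ℕ} (Z : List ℕ)
    (h : ¬ D.prec z y) : D.insertAbove y (z :: Z) = y :: z :: Z := by
  simp [insertAbove, h]

theorem perm_insertAbove (D : DyckPath n) (y : ℕ) (Z : List ℕ) :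
    (D.insertAbove y Z).Perm (y :: Z) :=
  List.perm_orderedInsert _ _ _

theorem insertAbove_injective (D : DyckPath n) (y : ℕ) :
    Function.Injective (D.insertAbove y) := by
  intro Z Z' h
  induction Z generalizing Z' with
  | nil =>
    have := congrArg List.length h
    simp only [(D.perm_insertAbove _ _).length_eq] at this
    exact (List.length_eq_zero_iff.1 (by simpa using this.symm)).symm
  | cons b Z ih =>
    cases Z' with
    | nil =>
      have := congrArg List.length h
      simp [(D.perm_insertAbove _ _).length_eq] at this
    | cons b' Z' =>
      by_cases hb : D.prec b y <;> by_cases hb' : D.prec b' y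
      · rw [D.insertAbove_cons_of_prec _ hb, D.insertAbove_cons_of_prec _ hb'] at h
        obtain ⟨rfl, hZ⟩ := List.cons.inj h
        rw [ih hZ]
      · rw [D.insertAbove_cons_of_prec _ hb, D.insertAbove_cons_of_not_prec _ hb'] at h
        exact absurd ((List.cons.inj h).1 ▸ hb) (D.prec_irrefl y)
      · rw [D.insertAbove_cons_of_not_prec _ hb, D.insertAbove_cons_of_prec _ hb'] at h
        exact absurd ((List.cons.inj h).1 ▸ hb') (D.prec_irrefl y)
      · rw [D.insertAbove_cons_of_not_prec _ hb, D.insertAbove_cons_of_not_prec _ hb'] at h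
        exact (List.cons.inj h).2

theorem isChain_cons_insertAbove (D : DyckPath n) {x y : ℕ} (hxy : D.prec x y) (Z : List ℕ) :
    (x :: D.insertAbove y Z).IsChain (fun u v => ¬ D.prec v u) ↔
      (x :: Z).IsChain fun u v => ¬ D.prec v u := by
  have hyx : ¬ D.prec y x := fun h => D.prec_irrefl _ (D.prec_trans h hxy)
  induction Z generalizing x with
  | nil => simp [insertAbove_nil, hyx]
  | cons b Z ih =>
    by_cases hb : D.prec b y
    · have hyb : ¬ D.prec y b := fun h => D.prec_irrefl _ (D.prec_trans h hb)
      rw [D.insertAbove_cons_of_prec _ hb, List.isChain_cons_cons, List.isChain_cons_cons]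
      exact and_congr_right fun _ => ih hb hyb
    · rw [D.insertAbove_cons_of_not_prec _ hb]
      have : ¬ D.prec b x := fun h => hb (D.prec_trans h hxy)
      simp [hyx, hb, this]

theorem pairCount_swap (D : DyckPath n) {y z : ℕ} (h : D.prec z y) (Z : List ℕ) :
    pairCount D.Inverted (y :: z :: Z) = pairCount D.Inverted (z :: y :: Z) := by
  have h1 : ¬ D.Inverted y z := fun h' => h'.2.2 h
  have h2 : ¬ D.Inverted z y := fun h' => h'.2.1 h
  simp [pairCount, h1, h2]
  omega

theorem pairCount_insertAbove (D : DyckPath n) (y : ℕ) (Z : List ℕ) :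
    pairCount D.Inverted (D.insertAbove y Z) = pairCount D.Inverted (y :: Z) := by
  induction Z with
  | nil => rfl
  | cons b Z ih =>
    by_cases hb : D.prec b y
    · rw [D.insertAbove_cons_of_prec _ hb, D.pairCount_swap hb]
      exact pairCount_append_congr _ [b] (D.perm_insertAbove y Z) ih
    · rw [D.insertAbove_cons_of_not_prec _ hb]

theorem pairCount_append_insertAbove (D : DyckPath n) (A : List ℕ) (y : ℕ) (Z : List ℕ) :
    pairCount D.Inverted (A ++ D.insertAbove y Z) = pairCount D.Inverted (A ++ y :: Z) :=
  pairCount_append_congr _ A (D.perm_insertAbove y Z) (D.pairCount_insertAbove y Z)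

theorem prec_or_prec_of_insertAbove_eq (D : DyckPath n) {y y' : ℕ} {Z Z' : List ℕ}
    (hne : y ≠ y') (h : D.insertAbove y Z = D.insertAbove y' Z') :
    D.prec y y' ∨ D.prec y' y := by
  induction Z generalizing Z' with
  | nil =>
    cases Z' with
    | nil => simp [insertAbove_nil, hne] at h
    | cons b' Z' =>
      have := congrArg List.length h
      simp [(D.perm_insertAbove _ _).length_eq] at this
  | cons b Z ih =>
    cases Z' with
    | nil =>
      have := congrArg List.length h
      simp [(D.perm_insertAbove _ _).length_eq] at this
    | cons b' Z' =>
      by_cases hb : D.prec b y <;> by_cases hb' : D.prec b' y'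
      · rw [D.insertAbove_cons_of_prec _ hb, D.insertAbove_cons_of_prec _ hb'] at h
        exact ih (List.cons.inj h).2
      · rw [D.insertAbove_cons_of_prec _ hb, D.insertAbove_cons_of_not_prec _ hb'] at h
        exact Or.inr ((List.cons.inj h).1 ▸ hb)
      · rw [D.insertAbove_cons_of_not_prec _ hb, D.insertAbove_cons_of_prec _ hb'] at h
        exact Or.inl ((List.cons.inj h).1 ▸ hb')
      · rw [D.insertAbove_cons_of_not_prec _ hb, D.insertAbove_cons_of_not_prec _ hb'] at h
        exact absurd (List.cons.inj h).1 hne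

theorem exists_eq_insertAbove (D : DyckPath n) {y y' : ℕ} {Z Z' : List ℕ} (hyy : D.prec y y')
    (h : D.insertAbove y Z = D.insertAbove y' Z') (hc : Z'.IsChain fun u v => ¬ D.prec v u) :
    ∃ Y, Z' = D.insertAbove y Y := by
  have hne : y ≠ y' := fun e => D.prec_irrefl _ (e ▸ hyy)
  have hn : ¬ D.prec y' y := fun h => D.prec_irrefl _ (D.prec_trans h hyy)
  induction Z' generalizing Z with
  | nil =>
    cases Z with
    | nil => simp [insertAbove_nil, hne] at h
    | cons b Z =>
      have := congrArg List.length h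
      simp [(D.perm_insertAbove _ _).length_eq] at this
  | cons b' Z' ih =>
    cases Z with
    | nil =>
      have := congrArg List.length h
      simp [(D.perm_insertAbove _ _).length_eq] at this
    | cons b Z =>
      by_cases hb : D.prec b y <;> by_cases hb' : D.prec b' y'
      · rw [D.insertAbove_cons_of_prec _ hb, D.insertAbove_cons_of_prec _ hb'] at h
        obtain ⟨rfl, hZ⟩ := List.cons.inj h
        obtain ⟨Y, rfl⟩ := ih hZ hc.tail
        exact ⟨b :: Y, (D.insertAbove_cons_of_prec _ hb).symm⟩
      · rw [D.insertAbove_cons_of_prec _ hb, D.insertAbove_cons_of_not_prec _ hb'] at h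
        exact absurd ((List.cons.inj h).1 ▸ hb) hn
      · rw [D.insertAbove_cons_of_not_prec _ hb, D.insertAbove_cons_of_prec _ hb'] at h
        obtain ⟨rfl, -⟩ := List.cons.inj h
        refine ⟨Z', ?_⟩
        cases Z' with
        | nil => rfl
        | cons c Z' => rw [D.insertAbove_cons_of_not_prec _ (List.isChain_cons_cons.1 hc).1]
      · rw [D.insertAbove_cons_of_not_prec _ hb, D.insertAbove_cons_of_not_prec _ hb'] at h
        exact absurd (List.cons.inj h).1 hne

theorem IsPTab.exists_decomp {D : DyckPath n} {l : ℕ} {L : List ℕ}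
    (h : D.IsPTab (shape l 1 (n - 3 * l - 2)) L) :
    ∃ A x y Z, L = A ++ x :: y :: Z ∧ A.length = 3 * l ∧ n = 3 * l + 2 + Z.length ∧
      RowwiseTab D.prec (List.replicate l 3 ++ 2 :: List.replicate Z.length 1)
        (A ++ x :: y :: Z) ∧
      D.prec x y ∧ (x :: Z).IsChain fun u v => ¬ D.prec v u := by
  have hlen := h.length_eq
  have hs := h.2.1
  simp [shape] at hs
  have hd : (L.drop (3 * l)).length = n - 3 * l := by simp [hlen]
  have hL := List.take_append_drop (3 * l) L
  have hA : (L.take (3 * l)).length = 3 * l := by simp [hlen]; omega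
  rcases hdr : L.drop (3 * l) with _ | ⟨x, _ | ⟨y, Z⟩⟩
  · rw [hdr] at hd; simp at hd; omega
  · rw [hdr] at hd; simp at hd; omega
  rw [hdr] at hd hL
  simp only [List.length_cons] at hd
  have ht := h.rowwiseTab
  have hZ : n - 3 * l - 2 = Z.length := by omega
  have ht' : RowwiseTab D.prec (List.replicate l 3 ++ 2 :: List.replicate Z.length 1)
      (L.take (3 * l) ++ x :: y :: Z) := by
    rw [hL, ← hZ]
    simpa [shape] using ht
  have hB := (rowwiseTab_cons_replicate_one _ x [y] Z).1 (ht'.of_replicate_append hA)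
  exact ⟨_, x, y, Z, hL.symm, hA, by omega, ht', by simpa using hB.1, hB.2⟩

/-- Move the last entry of the row of length two down into the first column. -/
noncomputable def lower (D : DyckPath n) (l : ℕ) (L : List ℕ) : List ℕ :=
  L.take (3 * l + 1) ++ D.insertAbove (L.getD (3 * l + 1) 0) (L.drop (3 * l + 2))

theorem lower_append (D : DyckPath n) {l : ℕ} {A : List ℕ} (hA : A.length = 3 * l) (x y : ℕ)
    (Z : List ℕ) : D.lower l (A ++ x :: y :: Z) = A ++ x :: D.insertAbove y Z := by
  have h1 : (A ++ x :: y :: Z).take (3 * l + 1) = A ++ [x] := by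
    rw [← hA, List.take_length_add_append]
    simp
  have h2 : (A ++ x :: y :: Z).drop (3 * l + 2) = Z := by
    rw [← hA, List.drop_length_add_append]
    simp
  rw [lower, h1, h2]
  simp [← hA]

theorem IsPTab.lower {D : DyckPath n} {l : ℕ} {L : List ℕ}
    (h : D.IsPTab (shape l 1 (n - 3 * l - 2)) L) :
    D.IsPTab (shape l 0 (n - 3 * l)) (D.lower l L) := by
  obtain ⟨A, x, y, Z, rfl, hA, hn, ht, hxy, hc⟩ := h.exists_decomp
  rw [D.lower_append hA]
  refine ⟨(((D.perm_insertAbove y Z).cons x).append_left A).trans h.1, ?_, ?_⟩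
  · simp [shape]; omega
  rw [← rowwiseTab_iff]
  have hlen : n - 3 * l = (D.insertAbove y Z).length + 1 := by
    rw [(D.perm_insertAbove y Z).length_eq, List.length_cons]; omega
  rw [hlen, shape, List.replicate_zero, List.append_nil, List.replicate_succ]
  refine ht.replace_tail hA
    ((rowwiseTab_cons_replicate_one _ x [] _).2 ⟨by simp, ?_⟩) fun j hj => ?_
  · exact (D.isChain_cons_insertAbove hxy Z).2 hc
  · obtain rfl : j = 0 := by simpa using hj
    simp

theorem IsPTab.invNum_lower {D : DyckPath n} {l : ℕ} {L : List ℕ}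
    (h : D.IsPTab (shape l 1 (n - 3 * l - 2)) L) :
    D.invNum (shape l 0 (n - 3 * l)) (D.lower l L) =
      D.invNum (shape l 1 (n - 3 * l - 2)) L := by
  rw [h.lower.invNum_eq, h.invNum_eq]
  obtain ⟨A, x, y, Z, rfl, hA, -⟩ := h.exists_decomp
  rw [D.lower_append hA]
  simpa using D.pairCount_append_insertAbove (A ++ [x]) y Z

/-- `U` is obtained from `S` by raising two entries of the first column of `S` into the first row
of length one. -/
def Raises (D : DyckPath n) (l : ℕ) (S U : List ℕ) : Prop :=
  ∃ A x y y' Y, A.length = 3 * l ∧ S = A ++ x :: D.insertAbove y' (D.insertAbove y Y) ∧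
    U = A ++ x :: y :: y' :: Y

theorem Raises.unique {D : DyckPath n} {l : ℕ} {S S' U : List ℕ} (h : D.Raises l S U)
    (h' : D.Raises l S' U) : S = S' := by
  obtain ⟨A, x, y, z, Y, hA, rfl, rfl⟩ := h
  obtain ⟨A', x', y', z', Y', hA', rfl, e⟩ := h'
  obtain ⟨rfl, he⟩ := List.append_inj e (hA.trans hA'.symm)
  simp only [List.cons.injEq] at he
  obtain ⟨rfl, rfl, rfl, rfl⟩ := he
  rfl

theorem lower_append_eq_iff (D : DyckPath n) {l : ℕ} {A A' : List ℕ} {x x' y y' : ℕ}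
    {Z Z' : List ℕ} (hA : A.length = 3 * l) (hA' : A'.length = 3 * l) :
    D.lower l (A ++ x :: y :: Z) = D.lower l (A' ++ x' :: y' :: Z') ↔
      A = A' ∧ x = x' ∧ D.insertAbove y Z = D.insertAbove y' Z' := by
  rw [D.lower_append hA, D.lower_append hA']
  constructor
  · intro e
    obtain ⟨rfl, he⟩ := List.append_inj e (hA.trans hA'.symm)
    exact ⟨rfl, List.cons.inj he⟩
  · rintro ⟨rfl, rfl, e⟩
    rw [e]

theorem getD_append_second {l : ℕ} {A : List ℕ} (hA : A.length = 3 * l) (x y : ℕ) (Z : List ℕ) :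
    (A ++ x :: y :: Z).getD (3 * l + 1) 0 = y := by
  simp [← hA]

theorem IsPTab.exists_raises {D : DyckPath n} (h3 : D.BounceThree) {l : ℕ} {L L' : List ℕ}
    (h : D.IsPTab (shape l 1 (n - 3 * l - 2)) L) (h' : D.IsPTab (shape l 1 (n - 3 * l - 2)) L')
    (e : D.lower l L = D.lower l L')
    (hlt : D.prec (L.getD (3 * l + 1) 0) (L'.getD (3 * l + 1) 0)) :
    ∃ U, D.IsPTab (shape (l + 1) 0 (n - 3 * l - 3)) U ∧ D.Raises l (D.lower l L') U ∧
      D.invNum (shape (l + 1) 0 (n - 3 * l - 3)) U =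
        D.invNum (shape l 1 (n - 3 * l - 2)) L' := by
  rw [h'.invNum_eq]
  have hb := fun x => h'.mem_bounds (x := x)
  have hperm := h'.1
  obtain ⟨A, x, y, Z, rfl, hA, hn, ht, hxy, hc⟩ := h.exists_decomp
  obtain ⟨A', x', y', Z', rfl, hA', hn', ht', hxy', hc'⟩ := h'.exists_decomp
  rw [D.lower_append_eq_iff hA hA'] at e
  obtain ⟨rfl, rfl, e⟩ := e
  rw [getD_append_second hA, getD_append_second hA] at hlt
  obtain ⟨Y, rfl⟩ := D.exists_eq_insertAbove hlt e hc'.tail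
  have hY := (D.isChain_cons_insertAbove hxy Y).1 hc'
  have hlen := (D.perm_insertAbove y Y).length_eq
  simp only [List.length_cons] at hlen
  have hp : (A ++ x :: y :: y' :: Y).Perm (A ++ x :: y' :: D.insertAbove y Y) :=
    (((List.Perm.swap y' y Y).trans ((D.perm_insertAbove y Y).symm.cons y')).cons x).append_left A
  have hU : D.IsPTab (shape (l + 1) 0 (n - 3 * l - 3)) (A ++ x :: y :: y' :: Y) := by
    refine ⟨hp.trans hperm, by simp [shape]; omega, ?_⟩
    rw [← rowwiseTab_iff]
    have hm : n - 3 * l - 3 = Y.length := by omega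
    rw [hm, shape, List.replicate_zero, List.append_nil, List.replicate_succ', List.append_assoc]
    refine ht.replace_tail hA ((rowwiseTab_cons_replicate_one _ x [y, y'] Y).2
      ⟨by simp [hxy, hlt], hY⟩) fun j hj => ?_
    have hj : j < 3 := by simpa using hj
    refine ⟨hj, ?_⟩
    interval_cases j
    · simp
    · simp
    · exact Or.inr fun u hu => h3.no_chain_four (hb x (by simp)).1 (hb u (by simp [hu])).2 hxy hlt
  refine ⟨_, hU, ⟨A, x, y, y', Y, hA, D.lower_append hA _ _ _, rfl⟩, ?_⟩
  rw [hU.invNum_eq]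
  have e1 := pairCount_append_congr D.Inverted (A ++ [x]) (List.Perm.swap y' y Y)
    (D.pairCount_swap hlt Y).symm
  have e2 := D.pairCount_append_insertAbove (A ++ [x, y']) y Y
  simp only [List.append_assoc, List.cons_append, List.nil_append] at e1 e2
  rw [e1, e2]

end DyckPath

/-- The inversion-preserving injection `α` from `P`-tableaux of shape
`3^l 2 1^{n-3l-2}` into those of shapes `3^l 1^{n-3l}` or `3^{l+1} 1^{n-3l-3}`. -/
theorem exists_injection_alpha
    (n : ℕ) (D : DyckPath n) (h3 : D.BounceThree)
    (l : ℕ) (hl : l ≤ min (n - D.m1) (min (D.m1 - D.m0) D.m0)) :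
    ∃ α : {L : List ℕ // D.IsPTab (shape l 1 (n - 3 * l - 2)) L} →
        {L : List ℕ // D.IsPTab (shape l 0 (n - 3 * l)) L} ⊕
          {L : List ℕ // D.IsPTab (shape (l + 1) 0 (n - 3 * l - 3)) L},
      Function.Injective α ∧
      ∀ T, Sum.elim (fun S => D.invNum (shape l 0 (n - 3 * l)) S.1)
          (fun S => D.invNum (shape (l + 1) 0 (n - 3 * l - 3)) S.1) (α T)
        = D.invNum (shape l 1 (n - 3 * l - 2)) T.1 := by
  refine exists_injective_sum_of_fibers (fun T => ⟨D.lower l T.1, T.2.lower⟩)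
    (fun T T' => D.prec (T.1.getD (3 * l + 1) 0) (T'.1.getD (3 * l + 1) 0))
    (fun S U => D.Raises l S.1 U.1) _ _ _ (fun T => T.2.invNum_lower) ?_ ?_ ?_
    (fun S S' U h h' => Subtype.ext (h.unique h'))
  · rintro ⟨L, h⟩ ⟨L', h'⟩ e hne
    simp only [Subtype.mk.injEq, ne_eq] at e hne ⊢
    obtain ⟨A, x, y, Z, rfl, hA, -⟩ := h.exists_decomp
    obtain ⟨A', x', y', Z', rfl, hA', -⟩ := h'.exists_decomp
    rw [D.lower_append_eq_iff hA hA'] at e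
    obtain ⟨rfl, rfl, e⟩ := e
    rw [DyckPath.getD_append_second hA, DyckPath.getD_append_second hA]
    refine D.prec_or_prec_of_insertAbove_eq (fun hy => hne ?_) e
    subst hy
    rw [D.insertAbove_injective y e]
  · rintro ⟨L, h⟩ ⟨L', h'⟩ ⟨L'', h''⟩ e - h1 h2
    simp only [Subtype.mk.injEq] at e h1 h2
    have hb := fun x => h.mem_bounds (x := x)
    have hb'' := fun x => h''.mem_bounds (x := x)
    obtain ⟨A, x, y, Z, rfl, hA, -, -, hxy, -⟩ := h.exists_decomp
    obtain ⟨A'', x'', y'', Z'', rfl, hA'', -⟩ := h''.exists_decomp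
    rw [DyckPath.getD_append_second hA] at h1
    rw [DyckPath.getD_append_second hA''] at h2
    exact h3.no_chain_four (hb x (by simp)).1 (hb'' y'' (by simp)).2 hxy h1 h2
  · rintro ⟨L, h⟩ ⟨L', h'⟩ e hlt
    obtain ⟨U, hU, hR, hi⟩ := h.exists_raises h3 h' (congrArg Subtype.val e) hlt
    exact ⟨⟨U, hU⟩, hR, hi⟩
end

section
/- Let P = P(d) be the natural unit interval order on {1,…,n} of a Dyck path d with bounce number 3, and let 0 ≤ l ≤ min{a,b,c}. Then there exists an injective map g from the set of P-tableaux of shape 3^{l+1} 2^1 1^{n-3l-5} into the set of P-tableaux of shape 3^l 2^2 1^{n-3l-4}, such that inv(g(T)) = inv(T) for every T in the domain. -/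
open scoped Classical

theorem entry_flatten (R : List (List ℕ)) (i j : ℕ) (hj : j < (R.getD i []).length) :
    entry (R.map List.length) R.flatten i j = (R.getD i []).getD j 0 := by
  induction R generalizing i with
  | nil => simp at hj
  | cons r R ih =>
    cases i with
    | zero =>
      simp only [List.getD_cons_zero] at hj
      simp [entry, rowStart, List.getElem?_append_left hj]
    | succ i =>
      simp only [List.getD_cons_succ] at hj ⊢
      rw [← ih i hj]
      simp only [entry, rowStart, List.map_cons, List.take_succ_cons, List.sum_cons,
        List.flatten_cons]
      rw [List.getD_append_right _ _ _ _ (by omega)]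
      congr 1
      omega

theorem getD_map_length (R : List (List ℕ)) (i : ℕ) :
    (R.map List.length).getD i 0 = (R.getD i []).length := by
  rw [← List.length_nil (α := ℕ), List.getD_map]

/-- The row `s` may be placed directly below the row `r` in a tableau. -/
def RowBelow {n : ℕ} (D : DyckPath n) (r s : List ℕ) : Prop :=
  ∀ j < s.length, ¬ D.prec (s.getD j 0) (r.getD j 0)

/-- The conditions on a tableau, in terms of the list of its rows. -/
theorem isPTab_flatten_iff {n : ℕ} (D : DyckPath n) (R : List (List ℕ))
    (hR : (R.map List.length).Pairwise (· ≥ ·)) :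
    D.IsPTab (R.map List.length) R.flatten ↔
      R.flatten.Perm (List.map (· + 1) (List.range n)) ∧ (R.map List.length).sum = n ∧
      (∀ r ∈ R, r.IsChain D.prec) ∧ R.IsChain (RowBelow D) := by
  unfold DyckPath.IsPTab
  refine and_congr_right fun _ => and_congr_right fun _ => and_congr ?_ ?_
  · simp only [getD_map_length, List.length_map, List.forall_mem_iff_getElem,
      List.isChain_iff_getElem]
    refine forall_congr' fun i => ?_
    constructor
    · intro h hi j hj
      have := h j hi (by simpa [hi] using hj)
      rw [entry_flatten _ _ _ (by simp [hi]; omega), entry_flatten _ _ _ (by simp [hi]; omega)]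
        at this
      simpa [hi, hj, Nat.lt_of_succ_lt hj] using this
    · intro h j hi hj
      rw [entry_flatten _ _ _ (by omega), entry_flatten _ _ _ (by omega)]
      simp only [hi, List.getD_eq_getElem] at hj ⊢
      rw [List.getD_eq_getElem _ _ hj, List.getD_eq_getElem _ _ (Nat.lt_of_succ_lt hj)]
      exact h hi j hj
  · simp only [getD_map_length, List.length_map, List.isChain_iff_getElem, RowBelow]
    refine forall_congr' fun i => ?_
    have key : ∀ hi : i + 1 < R.length, R[i + 1].length ≤ R[i].length := fun hi => by
      have := List.pairwise_iff_getElem.1 hR i (i + 1) (by simp; omega) (by simpa using hi)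
        (by omega)
      simpa using this
    constructor
    · intro h hi j hj
      have := key hi
      have h2 := h j hi (by simpa [hi] using hj)
      rw [entry_flatten _ _ _ (by simpa [hi] using hj),
        entry_flatten _ _ _ (by simp [Nat.lt_of_succ_lt hi]; omega)] at h2
      simpa [hi, Nat.lt_of_succ_lt hi] using h2
    · intro h j hi hj
      have := key hi
      simp only [hi, List.getD_eq_getElem] at hj
      rw [entry_flatten _ _ _ (by simpa [hi] using hj),
        entry_flatten _ _ _ (by simp [Nat.lt_of_succ_lt hi]; omega)]
      simpa [hi, Nat.lt_of_succ_lt hi] using h hi j hj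

/-- The total weight of the pairs consisting of an entry of `u` and an entry of `v`. -/
def crossWeight (w : ℕ → ℕ → ℕ) (u v : List ℕ) : ℕ :=
  (u.map fun x => (v.map fun y => w x y).sum).sum

/-- The total weight of the pairs of entries in different rows, higher row first. -/
def rowsWeight (w : ℕ → ℕ → ℕ) : List (List ℕ) → ℕ
  | [] => 0
  | r :: R => crossWeight w r R.flatten + rowsWeight w R

section weight

variable (w : ℕ → ℕ → ℕ)

theorem crossWeight_append_left (u u' v : List ℕ) :
    crossWeight w (u ++ u') v = crossWeight w u v + crossWeight w u' v := by
  simp [crossWeight]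

theorem crossWeight_append_right (u v v' : List ℕ) :
    crossWeight w u (v ++ v') = crossWeight w u v + crossWeight w u v' := by
  simp [crossWeight, List.sum_map_add]

theorem crossWeight_perm {u u' v v' : List ℕ} (hu : u.Perm u') (hv : v.Perm v') :
    crossWeight w u v = crossWeight w u' v' := by
  unfold crossWeight
  rw [(hu.map _).sum_eq]
  congr 1
  exact List.map_congr_left fun x _ => (hv.map _).sum_eq

theorem rowsWeight_append (R S : List (List ℕ)) :
    rowsWeight w (R ++ S) =
      rowsWeight w R + crossWeight w R.flatten S.flatten + rowsWeight w S := by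
  induction R with
  | nil => simp [rowsWeight, crossWeight]
  | cons r R ih =>
    simp only [List.cons_append, rowsWeight, ih, List.flatten_append, List.flatten_cons,
      crossWeight_append_left, crossWeight_append_right]
    ring

theorem sum_range_getD {α : Type*} (l : List α) (e : α) (f : α → ℕ) :
    ∑ j ∈ Finset.range l.length, f (l.getD j e) = (l.map f).sum := by
  induction l with
  | nil => simp
  | cons a l ih =>
    rw [List.length_cons, Finset.sum_range_succ']
    simp only [List.getD_cons_succ, List.getD_cons_zero, ih, List.map_cons, List.sum_cons]
    ring

theorem crossWeight_flatten (r : List ℕ) (R : List (List ℕ)) :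
    crossWeight w r R.flatten = (R.map (crossWeight w r)).sum := by
  induction R with
  | nil => simp [crossWeight]
  | cons s R ih => simp [crossWeight_append_right, ih]

theorem rowsWeight_eq_sum (R : List (List ℕ)) :
    rowsWeight w R = ∑ i ∈ Finset.range R.length, ∑ k ∈ Finset.range R.length,
      if i < k then crossWeight w (R.getD i []) (R.getD k []) else 0 := by
  induction R with
  | nil => simp [rowsWeight]
  | cons r R ih =>
    rw [List.length_cons, Finset.sum_range_succ']
    simp only [Finset.sum_range_succ' _ R.length]
    simp only [List.getD_cons_succ, List.getD_cons_zero, Nat.add_lt_add_iff_right, ← ih,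
      Nat.not_lt_zero, if_false, Nat.succ_pos, if_true, add_zero]
    rw [sum_range_getD R [] (crossWeight w r), ← crossWeight_flatten, rowsWeight, add_comm]

theorem sum_cellsOf (μ : List ℕ) (F : ℕ → ℕ → ℕ) :
    ∑ p ∈ cellsOf μ, F p.1 p.2 =
      ∑ i ∈ Finset.range μ.length, ∑ j ∈ Finset.range (μ.getD i 0), F i j := by
  unfold cellsOf
  rw [Finset.sum_filter, Finset.sum_product]
  refine Finset.sum_congr rfl fun i hi => ?_
  have hle : μ.getD i 0 ≤ μ.foldr max 0 := by
    rw [List.getD_eq_getElem _ _ (Finset.mem_range.1 hi)]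
    exact List.le_max_of_le (List.getElem_mem _) le_rfl
  rw [← Finset.sum_filter]
  refine Finset.sum_congr ?_ fun _ _ => rfl
  ext j
  simp only [Finset.mem_filter, Finset.mem_range]
  omega

end weight

/-- The indicator of an inversion `(x, y)`. -/
noncomputable def invWeight {n : ℕ} (D : DyckPath n) (x y : ℕ) : ℕ :=
  if y < x ∧ D.Incomp x y then 1 else 0

theorem invNum_flatten {n : ℕ} (D : DyckPath n) (R : List (List ℕ)) :
    D.invNum (R.map List.length) R.flatten = rowsWeight (invWeight D) R := by
  unfold DyckPath.invNum
  rw [Finset.card_filter, Finset.sum_product]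
  set e := entry (R.map List.length) R.flatten with he
  rw [sum_cellsOf _ fun i j => ∑ q ∈ cellsOf (R.map List.length),
    if i < q.1 ∧ e q.1 q.2 < e i j ∧ D.Incomp (e i j) (e q.1 q.2) then 1 else 0]
  rw [rowsWeight_eq_sum, List.length_map]
  refine Finset.sum_congr rfl fun i hi => ?_
  have h1 : ∀ j, ∑ q ∈ cellsOf (R.map List.length),
      (if i < q.1 ∧ e q.1 q.2 < e i j ∧ D.Incomp (e i j) (e q.1 q.2) then 1 else 0) =
      ∑ k ∈ Finset.range R.length, ∑ m ∈ Finset.range (R.getD k []).length,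
        if i < k ∧ e k m < e i j ∧ D.Incomp (e i j) (e k m) then 1 else 0 := fun j => by
    rw [sum_cellsOf _ fun k m =>
      if i < k ∧ e k m < e i j ∧ D.Incomp (e i j) (e k m) then 1 else 0]
    simp only [List.length_map, getD_map_length]
  simp only [h1, getD_map_length]
  rw [Finset.sum_comm]
  refine Finset.sum_congr rfl fun k hk => ?_
  split_ifs with hik
  · rw [crossWeight, ← sum_range_getD (R.getD i []) 0]
    refine Finset.sum_congr rfl fun j hj => ?_
    rw [← sum_range_getD (R.getD k []) 0]
    refine Finset.sum_congr rfl fun m hm => ?_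
    rw [he, entry_flatten _ _ _ (Finset.mem_range.1 hj),
      entry_flatten _ _ _ (Finset.mem_range.1 hm), invWeight]
    simp [hik]
  · simp [hik]

theorem invWeight_eq_zero_of_prec {n : ℕ} {D : DyckPath n} {x y : ℕ} (h : D.prec x y) :
    invWeight D x y = 0 ∧ invWeight D y x = 0 := by
  simp [invWeight, DyckPath.Incomp, h]

/-- Insert `t` into the column `Z`, below the initial entries that are smaller than `t` in the
poset. -/
noncomputable def insertColumn {n : ℕ} (D : DyckPath n) (t : ℕ) (Z : List ℕ) : List ℕ :=
  Z.orderedInsert (fun u z => ¬ D.prec z u) t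

theorem insertColumn_perm {n : ℕ} (D : DyckPath n) (t : ℕ) (Z : List ℕ) :
    (insertColumn D t Z).Perm (t :: Z) :=
  List.perm_orderedInsert _ _ _

theorem insertColumn_cons {n : ℕ} (D : DyckPath n) (t z : ℕ) (Z : List ℕ) :
    insertColumn D t (z :: Z) = if D.prec z t then z :: insertColumn D t Z else t :: z :: Z := by
  simp only [insertColumn, List.orderedInsert_cons, ite_not]

theorem flatten_map_singleton (Z : List ℕ) : (Z.map fun z => [z]).flatten = Z := by
  induction Z <;> simp_all

theorem rowsWeight_insertColumn {n : ℕ} (D : DyckPath n) (t : ℕ) (Z : List ℕ) :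
    rowsWeight (invWeight D) ((insertColumn D t Z).map fun z => [z]) =
      crossWeight (invWeight D) [t] Z + rowsWeight (invWeight D) (Z.map fun z => [z]) := by
  induction Z with
  | nil => simp [insertColumn, rowsWeight]
  | cons z Z ih =>
    rw [insertColumn_cons]
    split_ifs with h
    · obtain ⟨h1, h2⟩ := invWeight_eq_zero_of_prec h
      rw [List.map_cons, rowsWeight, ih, flatten_map_singleton,
        crossWeight_perm _ (List.Perm.refl _) (insertColumn_perm D t Z)]
      simp only [List.map_cons, rowsWeight, flatten_map_singleton]
      simp only [crossWeight, List.map_cons, List.map_nil, List.sum_cons, List.sum_nil, h1, h2]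
      ring
    · simp [rowsWeight, flatten_map_singleton]

theorem isChain_insertColumn {n : ℕ} (D : DyckPath n) {t : ℕ} (h : ℕ) (Z : List ℕ)
    (ht : ∀ u ∈ h :: Z, ¬ D.prec t u) (hZ : (h :: Z).IsChain fun u v => ¬ D.prec v u) :
    (h :: insertColumn D t Z).IsChain fun u v => ¬ D.prec v u := by
  induction Z generalizing h with
  | nil => simpa [insertColumn] using ht
  | cons z Z ih =>
    rw [List.isChain_cons_cons] at hZ
    rw [insertColumn_cons]
    split_ifs with hz
    · rw [List.isChain_cons_cons]
      exact ⟨hZ.1, ih z (fun u hu => ht u (List.mem_cons_of_mem _ hu)) hZ.2⟩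
    · simpa [List.isChain_cons_cons, ht h List.mem_cons_self, hz] using hZ.2

theorem insertColumn_injective {n : ℕ} (D : DyckPath n) {M t t' : ℕ} (ht : M < t) (ht' : M < t')
    (hM : ∀ z, D.prec z t → z ≤ M) (hM' : ∀ z, D.prec z t' → z ≤ M) (Z Z' : List ℕ)
    (h : insertColumn D t Z = insertColumn D t' Z') : t = t' ∧ Z = Z' := by
  induction Z generalizing Z' with
  | nil =>
    cases Z' with
    | nil => simpa [insertColumn] using h
    | cons z' Z' =>
      have := congrArg List.length h
      simp [insertColumn, List.orderedInsert_length, -List.orderedInsert_cons] at this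
  | cons z Z ih =>
    cases Z' with
    | nil =>
      have := congrArg List.length h
      simp [insertColumn, List.orderedInsert_length, -List.orderedInsert_cons] at this
    | cons z' Z' =>
      rw [insertColumn_cons, insertColumn_cons] at h
      split_ifs at h with h1 h2 h2
      · simp only [List.cons.injEq] at h ⊢
        obtain ⟨e1, e2⟩ := ih _ h.2
        exact ⟨e1, h.1, e2⟩
      · have := hM _ h1
        simp only [List.cons.injEq] at h
        omega
      · have := hM' _ h2
        simp only [List.cons.injEq] at h
        omega
      · simp_all

/-- The entries `p, q, r, s, t` replacing consecutive rows `(a, b, c)` and `(x, y)`: the new rows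
are `(p, q)` and `(r, s)`, and `t` is to be inserted into the first column below. -/
def rearrange (d : ℕ → ℕ) (M a b c x y : ℕ) : ℕ × ℕ × ℕ × ℕ × ℕ :=
  if M < y then
    if d x < c then (a, b, x, c, y) else (a, b, x, y, c)
  else if d y < c then (a, b, x, y, c)
  else if d x < b then (a, y, x, b, c)
  else (x, y, a, b, c)

/-- Rows `(a, b, c)` and `(x, y)` with distinct entries, which may be consecutive rows of a
tableau. -/
structure AdmissibleRows {n : ℕ} (D : DyckPath n) (a b c x y : ℕ) : Prop where
  mem : ∀ u ∈ [a, b, c, x, y], 1 ≤ u ∧ u ≤ n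
  nodup : [a, b, c, x, y].Nodup
  prec_ab : D.d a < b
  prec_bc : D.d b < c
  prec_xy : D.d x < y
  below_xa : a ≤ D.d x
  below_yb : b ≤ D.d y

section bounce

variable {n : ℕ} {D : DyckPath n}

theorem prec_iff {i j : ℕ} (hi : i ≤ n) (hj : j ≤ n) : D.prec i j ↔ D.d i < j := by
  refine ⟨And.right, fun h => ⟨lt_of_le_of_ne hi ?_, h⟩⟩
  rintro rfl
  have := D.top
  omega

theorem le_m1_of_d_lt (h3 : D.BounceThree) {i j : ℕ} (hi : i ≤ n) (hj : j ≤ n)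
    (h : D.d i < j) : i ≤ D.m1 := by
  by_contra hlt
  have h2 : D.d (D.m1 + 1) = n := h3.2.2
  have := D.mono (D.m1 + 1) i (by omega) (by omega) hi
  omega

theorem m1_lt_of_d_lt {i j k : ℕ} (hi : 1 ≤ i) (hj : j ≤ n)
    (hin : i ≤ n) (hij : D.d i < j) (hjk : D.d j < k) : D.m1 < k := by
  have h0 : D.d 1 = D.m0 := rfl
  have h1 : D.d (D.m0 + 1) = D.m1 := rfl
  have := D.mono 1 i le_rfl hi hin
  have := D.mono (D.m0 + 1) j (by omega) (by omega) hj
  omega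

theorem invWeight_eq {x y : ℕ} (hx : 1 ≤ x) (hxn : x ≤ n) (hyn : y ≤ n) :
    invWeight D x y = if y < x ∧ x ≤ D.d y then 1 else 0 := by
  have := D.ge_self x hx hxn
  simp only [invWeight, DyckPath.Incomp, prec_iff hxn hyn, prec_iff hyn hxn]
  congr 1
  apply propext
  omega

theorem AdmissibleRows.rearrange_spec (h3 : D.BounceThree) {a b c x y p q r s t : ℕ}
    (h : AdmissibleRows D a b c x y) (e : rearrange D.d D.m1 a b c x y = (p, q, r, s, t)) :
    [p, q, r, s, t].Perm [a, b, c, x, y] ∧ D.d p < q ∧ D.d r < s ∧ p ≤ D.d r ∧ q ≤ D.d s ∧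
      D.m1 < t ∧ a ≤ p ∧ b ≤ q ∧ r ≤ x ∧
      crossWeight (invWeight D) [p, q] [r, s] + crossWeight (invWeight D) [p, q, r, s] [t] =
        crossWeight (invWeight D) [a, b, c] [x, y] := by
  obtain ⟨hm, hn, hab, hbc, hxy, hxa, hyb⟩ := h
  simp only [List.mem_cons, List.not_mem_nil, or_false, forall_eq_or_imp, forall_eq] at hm
  obtain ⟨⟨ha, ha'⟩, ⟨hb, hb'⟩, ⟨hc, hc'⟩, ⟨hx, hx'⟩, ⟨hy, hy'⟩⟩ := hm
  have hMc := m1_lt_of_d_lt ha hb' ha' hab hbc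
  have hMy := m1_lt_of_d_lt (k := y) ha hb' ha' hab
  have hMy' := m1_lt_of_d_lt (D := D) (i := a) (j := x) (k := y) ha hx' ha'
  have hx1 := le_m1_of_d_lt h3 hx' hy' hxy
  have hb1 := le_m1_of_d_lt h3 hb' hc' hbc
  have hyM : D.m1 < y → D.d y = n := fun h => by
    have h2 : D.d (D.m1 + 1) = n := h3.2.2
    have := D.mono (D.m1 + 1) y (by omega) (by omega) hy'
    have := D.le_n y hy hy'
    omega
  have hdc : D.d c = n := by
    have h2 : D.d (D.m1 + 1) = n := h3.2.2
    have := D.mono (D.m1 + 1) c (by omega) (by omega) hc'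
    have := D.le_n c hc hc'
    omega
  have ga := D.ge_self a ha ha'
  have gb := D.ge_self b hb hb'
  have gx := D.ge_self x hx hx'
  have gy := D.ge_self y hy hy'
  have mono : ∀ {u v}, 1 ≤ u → v ≤ n → D.d v < D.d u → v < u := fun {u v} hu hv huv => by
    by_contra hle
    exact absurd (D.mono u v hu (by omega) hv) (by omega)
  have m1 := @mono a x ha hx'
  have m2 := @mono b x hb hx'
  have m3 := @mono b y hb hy'
  have m4 := @mono x a hx ha'
  have m5 := @mono x b hx hb'
  have m6 := @mono y b hy hb'
  have hne : y ≠ c := by rintro rfl; simp at hn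
  have hne' : x ≠ b := by rintro rfl; simp at hn
  have hne2 : x ≠ a := by rintro rfl; simp at hn
  have hne3 : y ≠ b := by rintro rfl; simp at hn
  clear mono hn
  unfold rearrange at e
  simp only [crossWeight, List.map_cons, List.map_nil, List.sum_cons, List.sum_nil]
  split_ifs at e <;> simp only [Prod.mk.injEq] at e <;>
    obtain ⟨rfl, rfl, rfl, rfl, rfl⟩ := e <;>
    (refine ⟨?_, by omega, by omega, by omega, by omega, by omega, by omega, by omega,
      by omega, ?_⟩
     · grind
     · simp only [invWeight_eq, *]
       grind)

theorem AdmissibleRows.rearrange_injective (h3 : D.BounceThree) {a b c x y a' b' c' x' y' : ℕ}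
    (h : AdmissibleRows D a b c x y) (h' : AdmissibleRows D a' b' c' x' y')
    (e : rearrange D.d D.m1 a b c x y = rearrange D.d D.m1 a' b' c' x' y') :
    a = a' ∧ b = b' ∧ c = c' ∧ x = x' ∧ y = y' := by
  obtain ⟨hm, -, hab, hbc, hxy, hxa, hyb⟩ := h
  obtain ⟨hm', -, hab', hbc', hxy', hxa', hyb'⟩ := h'
  simp only [List.mem_cons, List.not_mem_nil, or_false, forall_eq_or_imp, forall_eq] at hm hm'
  have hMc := m1_lt_of_d_lt hm.1.1 hm.2.1.2 hm.1.2 hab hbc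
  have hb1 := le_m1_of_d_lt h3 hm.2.1.2 hm.2.2.1.2 hbc
  have hMc' := m1_lt_of_d_lt hm'.1.1 hm'.2.1.2 hm'.1.2 hab' hbc'
  have hb1' := le_m1_of_d_lt h3 hm'.2.1.2 hm'.2.2.1.2 hbc'
  have mono : ∀ {u v}, 1 ≤ u → v ≤ n → D.d v < D.d u → v < u := fun {u v} hu hv huv => by
    by_contra hle
    exact absurd (D.mono u v hu (by omega) hv) (by omega)
  have m1 := @mono b y hm.2.1.1 hm.2.2.2.2.2
  have m2 := @mono b' y' hm'.2.1.1 hm'.2.2.2.2.2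
  clear mono
  unfold rearrange at e
  split_ifs at e <;> simp only [Prod.mk.injEq] at e <;>
    obtain ⟨rfl, rfl, rfl, rfl, rfl⟩ := e <;> omega

end bounce

theorem exists_eq_map_singleton {m : ℕ} {R : List (List ℕ)}
    (h : R.map List.length = List.replicate m 1) :
    ∃ Z : List ℕ, Z.length = m ∧ R = Z.map fun z => [z] := by
  induction R generalizing m with
  | nil => exact ⟨[], by simpa using congrArg List.length h, rfl⟩
  | cons r R ih =>
    cases m with
    | zero => simp at h
    | succ m =>
      rw [List.replicate_succ, List.map_cons, List.cons.injEq] at h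
      obtain ⟨Z, hZ, rfl⟩ := ih h.2
      obtain ⟨z, rfl⟩ := List.length_eq_one_iff.1 h.1
      exact ⟨z :: Z, by simp [hZ], rfl⟩

theorem map_length_map_singleton (Z : List ℕ) :
    (Z.map fun z => [z]).map List.length = List.replicate Z.length 1 := by
  induction Z <;> simp_all [List.replicate_succ]

theorem exists_rows_of_shape {l m : ℕ} {L : List ℕ} (h : L.length = (shape (l + 1) 1 m).sum) :
    ∃ (A : List (List ℕ)) (a b c x y : ℕ) (Z : List ℕ),
      A.map List.length = List.replicate l 3 ∧ Z.length = m ∧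
        L = (A ++ [a, b, c] :: [x, y] :: Z.map fun z => [z]).flatten := by
  have hf := List.flatten_splitLengths L _ h.le
  have hl := List.map_splitLengths_length L _ h.ge
  generalize (shape (l + 1) 1 m).splitLengths L = R at hf hl
  rw [shape, List.replicate_succ', List.append_assoc, List.append_assoc,
    List.map_eq_append_iff] at hl
  obtain ⟨A, R', rfl, hA, hR'⟩ := hl
  simp only [List.replicate_one, List.singleton_append, List.map_eq_cons_iff] at hR'
  obtain ⟨u, R'', rfl, hu, v, R3, rfl, hv, hR⟩ := hR'
  obtain ⟨Z, hZ, rfl⟩ := exists_eq_map_singleton hR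
  obtain ⟨a, b, c, rfl⟩ := List.length_eq_three.1 hu
  obtain ⟨x, y, rfl⟩ := List.length_eq_two.1 hv
  exact ⟨A, a, b, c, x, y, Z, hA, hZ, hf.symm⟩

theorem shape_pairwise (l j m : ℕ) : (shape l j m).Pairwise (· ≥ ·) := by
  simp only [shape, List.pairwise_append, List.pairwise_replicate, List.mem_append,
    List.mem_replicate]
  refine ⟨⟨Or.inr le_rfl, Or.inr le_rfl, ?_⟩, Or.inr le_rfl, ?_⟩ <;> intros <;> omega

section column

variable {n : ℕ} {D : DyckPath n}

theorem isChain_rowBelow_column (x y : ℕ) (Z : List ℕ) :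
    ([x, y] :: Z.map fun z => [z]).IsChain (RowBelow D) ↔
      (x :: Z).IsChain fun u v => ¬ D.prec v u := by
  cases Z with
  | nil => simp
  | cons z Z =>
    rw [List.map_cons, List.isChain_cons_cons, List.isChain_cons_cons,
      ← List.map_cons (f := fun z => [z]), List.isChain_map]
    simp [RowBelow]

theorem rowBelow_pair (u : List ℕ) (x y : ℕ) :
    RowBelow D u [x, y] ↔ ¬ D.prec x (u.getD 0 0) ∧ ¬ D.prec y (u.getD 1 0) := by
  constructor
  · exact fun h => ⟨h 0 (by simp), h 1 (by simp)⟩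
  · rintro ⟨h0, h1⟩ (_ | _ | j) hj
    · exact h0
    · exact h1
    · simp at hj

theorem prec_of_prec_of_le {i k j : ℕ} (hi : 1 ≤ i) (hik : i ≤ k) (h : D.prec k j) :
    D.prec i j :=
  ⟨hik.trans_lt h.1, (D.mono i k hi hik h.1.le).trans_lt h.2⟩

theorem mem_of_perm {L : List ℕ} (h : L.Perm (List.map (· + 1) (List.range n))) {u : ℕ}
    (hu : u ∈ L) : 1 ≤ u ∧ u ≤ n := by
  obtain ⟨k, hk, rfl⟩ := List.mem_map.1 (h.subset hu)
  have := List.mem_range.1 hk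
  omega

end column

/-- Rearranging the last row of length three together with the row of length two below it sends
tableaux to tableaux and preserves the number of inversions. -/
theorem isPTab_rearrange {n : ℕ} {D : DyckPath n} (h3 : D.BounceThree) {l m : ℕ}
    {A : List (List ℕ)} {a b c x y : ℕ} {Z : List ℕ}
    (hA : A.map List.length = List.replicate l 3) (hZ : Z.length = m)
    (h : D.IsPTab (shape (l + 1) 1 m) (A ++ [a, b, c] :: [x, y] :: Z.map fun z => [z]).flatten)
    {p q r s t : ℕ} (e : rearrange D.d D.m1 a b c x y = (p, q, r, s, t)) :
    AdmissibleRows D a b c x y ∧ (D.m1 < t ∧ t ≤ n) ∧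
      D.IsPTab (shape l 2 (m + 1))
        (A ++ [p, q] :: [r, s] :: (insertColumn D t Z).map fun z => [z]).flatten ∧
      D.invNum (shape l 2 (m + 1))
        (A ++ [p, q] :: [r, s] :: (insertColumn D t Z).map fun z => [z]).flatten =
      D.invNum (shape (l + 1) 1 m)
        (A ++ [a, b, c] :: [x, y] :: Z.map fun z => [z]).flatten := by
  have hμ : shape (l + 1) 1 m =
      (A ++ [a, b, c] :: [x, y] :: Z.map fun z => [z]).map List.length := by
    rw [List.map_append, hA, List.map_cons, List.map_cons, map_length_map_singleton, hZ, shape,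
      List.replicate_succ']
    simp
  have hlen : (insertColumn D t Z).length = m + 1 := by
    rw [insertColumn, List.orderedInsert_length, hZ]
  have hν : shape l 2 (m + 1) = (A ++ [p, q] :: [r, s] ::
      (insertColumn D t Z).map fun z => [z]).map List.length := by
    rw [List.map_append, hA, List.map_cons, List.map_cons, map_length_map_singleton, hlen, shape]
    simp [List.replicate_succ]
  have hsum : (shape l 2 (m + 1)).sum = (shape (l + 1) 1 m).sum := by
    simp [shape]
    ring
  have hμ' := shape_pairwise (l + 1) 1 m
  have hν' := shape_pairwise l 2 (m + 1)
  rw [hμ] at h hμ' hsum ⊢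
  rw [hν] at hν' hsum ⊢
  rw [isPTab_flatten_iff D _ hμ'] at h
  rw [isPTab_flatten_iff D _ hν', invNum_flatten, invNum_flatten, hsum]
  obtain ⟨hperm, hn, hrow, hcol⟩ := h
  have hmem : ∀ u ∈ [a, b, c, x, y], 1 ≤ u ∧ u ≤ n := fun u hu =>
    mem_of_perm hperm (by simp at hu ⊢; tauto)
  have hnodup : [a, b, c, x, y].Nodup := by
    have h1 := hperm.nodup_iff.2 (List.nodup_range.map (add_left_injective 1))
    refine h1.sublist ?_
    rw [List.flatten_append]
    refine List.Sublist.trans ?_ (List.sublist_append_right _ _)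
    rw [List.flatten_cons, List.flatten_cons, ← List.append_assoc]
    exact List.sublist_append_left _ _
  have hrow1 := hrow [a, b, c] (by simp)
  have hrow2 := hrow [x, y] (by simp)
  simp only [List.isChain_cons_cons, List.isChain_singleton, and_true] at hrow1 hrow2
  rw [List.isChain_append, List.isChain_cons_cons, isChain_rowBelow_column, rowBelow_pair] at hcol
  obtain ⟨hcolA, ⟨⟨hxa, hyb⟩, hcolZ⟩, hlast⟩ := hcol
  simp only [List.getD_cons_zero, List.getD_cons_succ] at hxa hyb
  have hm := hmem
  simp only [List.mem_cons, List.not_mem_nil, or_false, forall_eq_or_imp, forall_eq] at hm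
  obtain ⟨⟨ha, ha'⟩, ⟨hb, hb'⟩, ⟨hc, hc'⟩, ⟨hx, hx'⟩, ⟨hy, hy'⟩⟩ := hm
  rw [prec_iff hx' ha', not_lt] at hxa
  rw [prec_iff hy' hb', not_lt] at hyb
  have hadm : AdmissibleRows D a b c x y :=
    ⟨hmem, hnodup, hrow1.1.2, hrow1.2.2, hrow2.2, hxa, hyb⟩
  obtain ⟨hp5, hpq, hrs, hpr, hqs, ht, hap, hbq, hrx, hw⟩ := hadm.rearrange_spec h3 e
  have hmem' : ∀ u ∈ [p, q, r, s, t], 1 ≤ u ∧ u ≤ n := fun u hu => hmem u (hp5.subset hu)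
  simp only [List.mem_cons, List.not_mem_nil, or_false, forall_eq_or_imp, forall_eq] at hmem'
  obtain ⟨⟨hp, hp'⟩, ⟨hq, hq'⟩, ⟨hr, hr'⟩, ⟨hs, hs'⟩, ⟨ht1, ht'⟩⟩ := hmem'
  have hmax : ∀ u ≤ n, ¬ D.prec t u := fun u hun hu =>
    absurd (le_m1_of_d_lt h3 ht' hun hu.2) ht.not_ge
  have hbottom : ([p, q] :: [r, s] :: (insertColumn D t Z).map fun z => [z]).flatten.Perm
      ([a, b, c] :: [x, y] :: Z.map fun z => [z]).flatten := by
    simp only [List.flatten_cons, flatten_map_singleton, ← List.append_assoc]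
    refine ((insertColumn_perm D t Z).append_left _).trans ?_
    simpa using hp5.append_right Z
  refine ⟨hadm, ⟨ht, ht'⟩, ⟨?_, hn, ?_, ?_⟩, ?_⟩
  · refine List.Perm.trans ?_ hperm
    rw [List.flatten_append, List.flatten_append]
    exact hbottom.append_left _
  · intro u hu
    simp only [List.mem_append, List.mem_cons, List.mem_map] at hu
    rcases hu with hu | rfl | rfl | ⟨z, -, rfl⟩
    · exact hrow u (by simp [hu])
    · simpa [prec_iff hp' hq'] using hpq
    · simpa [prec_iff hr' hs'] using hrs
    · simp
  · rw [List.isChain_append, List.isChain_cons_cons, isChain_rowBelow_column, rowBelow_pair]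
    refine ⟨hcolA, ⟨⟨?_, ?_⟩, ?_⟩, ?_⟩
    · simpa [prec_iff hr' hp'] using hpr
    · simpa [prec_iff hs' hq'] using hqs
    · refine isChain_insertColumn D r Z (fun u hu => hmax u ?_) ?_
      · rcases List.mem_cons.1 hu with rfl | hu
        · exact hr'
        · exact (mem_of_perm hperm (by simp [hu])).2
      cases Z with
      | nil => simp
      | cons z Z =>
        rw [List.isChain_cons_cons] at hcolZ ⊢
        exact ⟨fun hz => hcolZ.1 ⟨hz.1, hz.2.trans_le hrx⟩, hcolZ.2⟩
    · intro u hu v hv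
      obtain rfl : [p, q] = v := by simpa using hv
      have h0 := hlast u hu [a, b, c] (by simp)
      rw [rowBelow_pair]
      exact ⟨fun h => h0 0 (by simp) (prec_of_prec_of_le ha hap h),
        fun h => h0 1 (by simp) (prec_of_prec_of_le hb hbq h)⟩
  · rw [rowsWeight_append, rowsWeight_append,
      crossWeight_perm _ (List.Perm.refl A.flatten) hbottom, add_assoc, add_assoc]
    congr 2
    simp only [rowsWeight, List.flatten_cons, flatten_map_singleton, rowsWeight_insertColumn]
    rw [← add_assoc, ← add_assoc]
    have hi := fun u => crossWeight_perm (invWeight D) (List.Perm.refl u) (insertColumn_perm D t Z)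
    have h5 := crossWeight_perm (invWeight D) hp5 (List.Perm.refl Z)
    rw [show [p, q, r, s, t] = [p, q] ++ [r, s] ++ [t] from rfl,
      show [a, b, c, x, y] = [a, b, c] ++ [x, y] from rfl] at h5
    rw [show [p, q, r, s] = [p, q] ++ [r, s] from rfl] at hw
    simp only [crossWeight_append_left, crossWeight_append_right, hi,
      ← List.singleton_append (l := Z) (x := t)] at h5 hw ⊢
    omega

/-- The inversion-preserving injection `g` from `P`-tableaux of shape
`3^{l+1} 2 1^{n-3l-5}` into those of shape `3^l 2^2 1^{n-3l-4}`. -/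
theorem exists_injection_g
    (n : ℕ) (D : DyckPath n) (h3 : D.BounceThree)
    (l : ℕ) (hl : l ≤ min (n - D.m1) (min (D.m1 - D.m0) D.m0)) :
    ∃ g : {L : List ℕ // D.IsPTab (shape (l + 1) 1 (n - 3 * l - 5)) L} →
        {L : List ℕ // D.IsPTab (shape l 2 (n - 3 * l - 4)) L},
      Function.Injective g ∧
      ∀ T, D.invNum (shape l 2 (n - 3 * l - 4)) (g T).1
        = D.invNum (shape (l + 1) 1 (n - 3 * l - 5)) T.1 := by
  have hT : ∀ T : {L : List ℕ // D.IsPTab (shape (l + 1) 1 (n - 3 * l - 5)) L},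
      ∃ (A : List (List ℕ)) (a b c x y : ℕ) (Z : List ℕ) (p q r s t : ℕ),
        A.map List.length = List.replicate l 3 ∧
        T.1 = (A ++ [a, b, c] :: [x, y] :: Z.map fun z => [z]).flatten ∧
        rearrange D.d D.m1 a b c x y = (p, q, r, s, t) ∧
        AdmissibleRows D a b c x y ∧ (D.m1 < t ∧ t ≤ n) ∧
        D.IsPTab (shape l 2 (n - 3 * l - 4))
          (A ++ [p, q] :: [r, s] :: (insertColumn D t Z).map fun z => [z]).flatten ∧
        D.invNum (shape l 2 (n - 3 * l - 4))
          (A ++ [p, q] :: [r, s] :: (insertColumn D t Z).map fun z => [z]).flatten =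
        D.invNum (shape (l + 1) 1 (n - 3 * l - 5)) T.1 := by
    rintro ⟨L, hL⟩
    have hlen : L.length = n := by simpa using hL.1.length_eq
    have hsum := hL.2.1
    obtain ⟨A, a, b, c, x, y, Z, hA, hZ, rfl⟩ := exists_rows_of_shape (hlen.trans hsum.symm)
    have hm : n - 3 * l - 4 = n - 3 * l - 5 + 1 := by
      simp [shape] at hsum
      omega
    rw [hm]
    exact ⟨A, a, b, c, x, y, Z, _, _, _, _, _, hA, rfl, rfl, isPTab_rearrange h3 hA hZ hL rfl⟩
  choose A a b c x y Z p q r s t hA hL he hadm ht hP hinv using hT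
  refine ⟨fun T => ⟨_, hP T⟩, fun T T' h => ?_, hinv⟩
  have hlen : ∀ T, (A T).flatten.length = 3 * l := fun T => by
    rw [List.length_flatten, hA]
    simp [mul_comm]
  have h := congrArg Subtype.val h
  simp only [List.flatten_append] at h
  obtain ⟨h1, h2⟩ := List.append_inj h ((hlen T).trans (hlen T').symm)
  simp only [List.flatten_cons, flatten_map_singleton, List.cons_append, List.nil_append,
    List.cons.injEq] at h2
  obtain ⟨hp, hq, hr, hs, hins⟩ := h2
  obtain ⟨htt, hZ⟩ := insertColumn_injective D (ht T).1 (ht T').1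
    (fun z hz => le_m1_of_d_lt h3 hz.1.le (ht T).2 hz.2)
    (fun z hz => le_m1_of_d_lt h3 hz.1.le (ht T').2 hz.2) _ _ hins
  obtain ⟨ea, eb, ec, ex, ey⟩ := (hadm T).rearrange_injective h3 (hadm T')
    (by rw [he, he, hp, hq, hr, hs, htt])
  apply Subtype.ext
  rw [hL T, hL T', List.flatten_append, List.flatten_append, h1, ea, eb, ec, ex, ey, hZ]
end

section
/- Let d be a Dyck path on an n×n board (n ≥ 6) of the form (d_1, d_2, n−1, …, n−1, n, …, n) (i.e., d_i ∈ {n−1, n} for all i ≥ 3) with bounce number 3, and let P = P(d). Then there exists an injective map ψ from the set of P-tableaux of shape 3^1 2^1 1^{n-5} into the set of P-tableaux of shape 2^3 1^{n-6}, such that inv(ψ(T)) = inv(T) for every T in the domain. -/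
open scoped Classical

namespace DyckPath

variable {n : ℕ}

/-- The contribution to `inv` of an entry `e` lying in a strictly higher row than `f`. -/
noncomputable def pairInv (D : DyckPath n) (e f : ℕ) : ℕ :=
  if f < e ∧ D.Incomp e f then 1 else 0

theorem invNum_eq_sum (D : DyckPath n) (μ L : List ℕ) :
    D.invNum μ L = ∑ c ∈ cellsOf μ, ∑ c' ∈ cellsOf μ,
      if c.1 < c'.1 then D.pairInv (entry μ L c.1 c.2) (entry μ L c'.1 c'.2) else 0 := by
  rw [invNum, Finset.card_filter, Finset.sum_product]
  refine Finset.sum_congr rfl fun c _ => Finset.sum_congr rfl fun c' _ => ?_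
  simp only [pairInv, ← ite_and]

theorem sum_cellsOf (μ : List ℕ) (F : ℕ → ℕ → ℕ) :
    ∑ c ∈ cellsOf μ, F c.1 c.2
      = ∑ i ∈ Finset.range μ.length, ∑ j ∈ Finset.range (μ.getD i 0), F i j := by
  have hmax : ∀ (l : List ℕ) (i : ℕ), l.getD i 0 ≤ l.foldr max 0 := by
    intro l
    induction l with
    | nil => simp
    | cons a t ih =>
      intro i
      cases i with
      | zero => simp
      | succ k => exact (ih k).trans (by simp)
  rw [cellsOf, Finset.sum_filter, Finset.sum_product]
  refine Finset.sum_congr rfl fun i _ => ?_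
  rw [← Finset.sum_filter]
  refine Finset.sum_congr ?_ fun _ _ => rfl
  ext j
  have := hmax μ i
  simp only [Finset.mem_filter, Finset.mem_range]
  omega

theorem shape_one_one (m : ℕ) : shape 1 1 m = 3 :: 2 :: List.replicate m 1 := rfl

theorem shape_zero_three (m : ℕ) : shape 0 3 m = 2 :: 2 :: 2 :: List.replicate m 1 := rfl

theorem sum_cellsOf_source (N : ℕ) (F : ℕ → ℕ → ℕ) :
    ∑ c ∈ cellsOf (shape 1 1 (N + 1)), F c.1 c.2
      = F 0 0 + F 0 1 + F 0 2 + F 1 0 + F 1 1 + F 2 0 + ∑ i ∈ Finset.range N, F (i + 3) 0 := by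
  rw [sum_cellsOf, shape_one_one, List.replicate_succ]
  simp only [List.length_cons, List.length_replicate, Finset.sum_range_succ', List.getD_cons_succ,
    List.getD_cons_zero, Finset.sum_range_zero]
  rw [Finset.sum_congr rfl (g := fun i => F (i + 3) 0)]
  · ring
  · intro i hi
    simp [List.getD_eq_getElem?_getD, Finset.mem_range.1 hi]

theorem sum_cellsOf_target (N : ℕ) (F : ℕ → ℕ → ℕ) :
    ∑ c ∈ cellsOf (shape 0 3 N), F c.1 c.2
      = F 0 0 + F 0 1 + F 1 0 + F 1 1 + F 2 0 + F 2 1 + ∑ i ∈ Finset.range N, F (i + 3) 0 := by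
  rw [sum_cellsOf, shape_zero_three]
  simp only [List.length_cons, List.length_replicate, Finset.sum_range_succ', List.getD_cons_succ,
    List.getD_cons_zero, Finset.sum_range_zero]
  rw [Finset.sum_congr rfl (g := fun i => F (i + 3) 0)]
  · ring
  · intro i hi
    simp [List.getD_eq_getElem?_getD, Finset.mem_range.1 hi]

theorem entry_source_tail (N i : ℕ) (hi : i < N) (x y z u v w : ℕ) (R : List ℕ) :
    entry (shape 1 1 (N + 1)) (x :: y :: z :: u :: v :: w :: R) (i + 3) 0 = R.getD i 0 := by
  have h : rowStart (shape 1 1 (N + 1)) (i + 3) = i + 6 := by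
    rw [shape_one_one, rowStart]
    simp [List.take_replicate]
    omega
  rw [entry, h]
  rfl

theorem entry_target_tail (N i : ℕ) (hi : i ≤ N) (p q r s t m : ℕ) (R : List ℕ) :
    entry (shape 0 3 N) (p :: q :: r :: s :: t :: m :: R) (i + 3) 0 = R.getD i 0 := by
  have h : rowStart (shape 0 3 N) (i + 3) = i + 6 := by
    rw [shape_zero_three, rowStart]
    simp [List.take_replicate]
    omega
  rw [entry, h]
  rfl

/-- Inversions between an entry of the first six cells and the tail `R`. -/
noncomputable def crossInv (D : DyckPath n) (R : List ℕ) (e : ℕ) : ℕ :=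
  ∑ i ∈ Finset.range R.length, D.pairInv e (R.getD i 0)

/-- Inversions within a tail `R` of one-cell rows. -/
noncomputable def tailInv (D : DyckPath n) (R : List ℕ) : ℕ :=
  ∑ i ∈ Finset.range R.length, ∑ j ∈ Finset.range R.length,
    if i < j then D.pairInv (R.getD i 0) (R.getD j 0) else 0

theorem invNum_source (D : DyckPath n) {N : ℕ} (x y z u v w : ℕ) (R : List ℕ)
    (hR : R.length = N) :
    D.invNum (shape 1 1 (N + 1)) (x :: y :: z :: u :: v :: w :: R)
      = (D.pairInv x u + D.pairInv x v + D.pairInv y u + D.pairInv y v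
          + D.pairInv z u + D.pairInv z v
          + D.pairInv x w + D.pairInv y w + D.pairInv z w + D.pairInv u w + D.pairInv v w)
        + (D.crossInv R x + D.crossInv R y + D.crossInv R z + D.crossInv R u + D.crossInv R v
          + D.crossInv R w) + D.tailInv R := by
  subst hR
  set L := x :: y :: z :: u :: v :: w :: R with hL
  set μ := shape 1 1 (R.length + 1) with hμ
  have e00 : entry μ L 0 0 = x := rfl
  have e01 : entry μ L 0 1 = y := rfl
  have e02 : entry μ L 0 2 = z := rfl
  have e10 : entry μ L 1 0 = u := rfl
  have e11 : entry μ L 1 1 = v := rfl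
  have e20 : entry μ L 2 0 = w := rfl
  have et : ∀ (G : ℕ → ℕ → ℕ), ∑ i ∈ Finset.range R.length, G i (entry μ L (i + 3) 0)
      = ∑ i ∈ Finset.range R.length, G i (R.getD i 0) := fun G =>
    Finset.sum_congr rfl fun i hi => by
      rw [hμ, hL, entry_source_tail _ _ (Finset.mem_range.1 hi)]
  rw [invNum_eq_sum, sum_cellsOf_source R.length fun i j => ∑ c' ∈ cellsOf μ,
    if i < c'.1 then D.pairInv (entry μ L i j) (entry μ L c'.1 c'.2) else 0]
  simp only [hμ, fun i e => sum_cellsOf_source R.length fun a b =>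
    if i < a then D.pairInv e (entry (shape 1 1 (R.length + 1)) L a b) else 0]
  simp only [← hμ, e00, e01, e02, e10, e11, e20]
  rw [et fun i e => (if i + 3 < 0 then D.pairInv e x else 0)
    + (if i + 3 < 0 then D.pairInv e y else 0) + (if i + 3 < 0 then D.pairInv e z else 0)
    + (if i + 3 < 1 then D.pairInv e u else 0) + (if i + 3 < 1 then D.pairInv e v else 0)
    + (if i + 3 < 2 then D.pairInv e w else 0)
      + ∑ j ∈ Finset.range R.length, if i + 3 < j + 3 then D.pairInv e (entry μ L (j + 3) 0) else 0]
  simp only [fun i e => et fun j f => if i < j + 3 then D.pairInv e f else 0]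
  simp [crossInv, tailInv]
  ring

theorem invNum_target (D : DyckPath n) {N : ℕ} (x y z u v w : ℕ) (R : List ℕ)
    (hR : R.length = N) :
    D.invNum (shape 0 3 N) (x :: y :: z :: u :: v :: w :: R)
      = (D.pairInv x z + D.pairInv x u + D.pairInv y z + D.pairInv y u
          + D.pairInv x v + D.pairInv x w + D.pairInv y v + D.pairInv y w
          + D.pairInv z v + D.pairInv z w + D.pairInv u v + D.pairInv u w)
        + (D.crossInv R x + D.crossInv R y + D.crossInv R z + D.crossInv R u + D.crossInv R v
          + D.crossInv R w) + D.tailInv R := by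
  subst hR
  set L := x :: y :: z :: u :: v :: w :: R with hL
  set μ := shape 0 3 R.length with hμ
  have e00 : entry μ L 0 0 = x := rfl
  have e01 : entry μ L 0 1 = y := rfl
  have e10 : entry μ L 1 0 = z := rfl
  have e11 : entry μ L 1 1 = u := rfl
  have e20 : entry μ L 2 0 = v := rfl
  have e21 : entry μ L 2 1 = w := rfl
  have et : ∀ (G : ℕ → ℕ → ℕ), ∑ i ∈ Finset.range R.length, G i (entry μ L (i + 3) 0)
      = ∑ i ∈ Finset.range R.length, G i (R.getD i 0) := fun G =>
    Finset.sum_congr rfl fun i hi => by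
      rw [hμ, hL, entry_target_tail _ _ (Finset.mem_range.1 hi).le]
  rw [invNum_eq_sum, sum_cellsOf_target R.length fun i j => ∑ c' ∈ cellsOf μ,
    if i < c'.1 then D.pairInv (entry μ L i j) (entry μ L c'.1 c'.2) else 0]
  simp only [hμ, fun i e => sum_cellsOf_target R.length fun a b =>
    if i < a then D.pairInv e (entry (shape 0 3 R.length) L a b) else 0]
  simp only [← hμ, e00, e01, e21, e10, e11, e20]
  rw [et fun i e => (if i + 3 < 0 then D.pairInv e x else 0)
    + (if i + 3 < 0 then D.pairInv e y else 0) + (if i + 3 < 1 then D.pairInv e z else 0)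
    + (if i + 3 < 1 then D.pairInv e u else 0) + (if i + 3 < 2 then D.pairInv e v else 0)
    + (if i + 3 < 2 then D.pairInv e w else 0)
      + ∑ j ∈ Finset.range R.length, if i + 3 < j + 3 then D.pairInv e (entry μ L (j + 3) 0) else 0]
  simp only [fun i e => et fun j f => if i < j + 3 then D.pairInv e f else 0]
  simp [crossInv, tailInv]
  ring

theorem exists_of_isPTab_source {N : ℕ} {D : DyckPath (N + 6)} {L : List ℕ}
    (h : D.IsPTab (shape 1 1 (N + 1)) L) :
    ∃ x y z u v w R, L = x :: y :: z :: u :: v :: w :: R ∧ R.length = N ∧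
      D.prec x y ∧ D.prec y z ∧ D.prec u v ∧
      ¬ D.prec u x ∧ ¬ D.prec v y ∧ ¬ D.prec w u := by
  have hlen := h.1.length_eq
  simp only [List.length_map, List.length_range] at hlen
  match L, hlen, h with
  | x :: y :: z :: u :: v :: w :: R, hlen, h =>
    exact ⟨x, y, z, u, v, w, R, rfl, by simpa using hlen,
      h.2.2.1 0 0 (by simp [shape]) (by simp [shape]),
      h.2.2.1 0 1 (by simp [shape]) (by simp [shape]),
      h.2.2.1 1 0 (by simp [shape]) (by simp [shape]),
      h.2.2.2 0 0 (by simp [shape]) (by simp [shape]),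
      h.2.2.2 0 1 (by simp [shape]) (by simp [shape]),
      h.2.2.2 1 0 (by simp [shape]) (by simp [shape])⟩

theorem isPTab_target {N : ℕ} {D : DyckPath (N + 6)} {p q r s t m : ℕ} {R : List ℕ}
    (hperm : (p :: q :: r :: s :: t :: m :: R).Perm ((List.range (N + 6)).map (· + 1)))
    (hR : R.length = N) (hpq : D.prec p q) (hrs : D.prec r s) (htm : D.prec t m)
    (hrp : ¬ D.prec r p) (hsq : ¬ D.prec s q) (htr : ¬ D.prec t r) (hms : ¬ D.prec m s)
    (ht : t < N + 6) (htail : ∀ e ∈ R, ∀ f < N + 6, ¬ D.prec e f) (hlt : ∀ e ∈ R, e < N + 6) :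
    D.IsPTab (shape 0 3 N) (p :: q :: r :: s :: t :: m :: R) := by
  have hmem : ∀ i < N, R.getD i 0 ∈ R := fun i hi => by
    rw [List.getD_eq_getElem _ _ (hR.symm ▸ hi)]
    exact List.getElem_mem _
  refine ⟨hperm, by simp [shape]; omega, ?_, ?_⟩
  · intro i j hi hj
    match i, hi, hj with
    | 0, _, hj =>
      obtain rfl : j = 0 := by simp [shape] at hj; omega
      exact hpq
    | 1, _, hj =>
      obtain rfl : j = 0 := by simp [shape] at hj; omega
      exact hrs
    | 2, _, hj =>
      obtain rfl : j = 0 := by simp [shape] at hj; omega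
      exact htm
    | i + 3, hi, hj =>
      have hi' : i < N := by simp [shape] at hi; omega
      simp [shape_zero_three, List.getD_eq_getElem?_getD, hi'] at hj
  · intro i j hi hj
    match i, hi, hj with
    | 0, _, hj =>
      have : j < 2 := by simpa [shape] using hj
      interval_cases j
      exacts [hrp, hsq]
    | 1, _, hj =>
      have : j < 2 := by simpa [shape] using hj
      interval_cases j
      exacts [htr, hms]
    | i + 2, hi, hj =>
      have hi' : i < N := by simp [shape] at hi; omega
      obtain rfl : j = 0 := by
        simpa [shape_zero_three, List.getD_eq_getElem?_getD, hi'] using hj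
      rw [show i + 2 + 1 = i + 3 from rfl, entry_target_tail _ _ hi'.le]
      refine htail _ (hmem i hi') _ ?_
      cases i with
      | zero => exact ht
      | succ k =>
        rw [show k + 1 + 2 = k + 3 from rfl, entry_target_tail _ _ (by omega)]
        exact hlt _ (hmem k (by omega))

theorem mem_Icc_of_perm {L : List ℕ} (h : L.Perm ((List.range n).map (· + 1))) {e : ℕ}
    (he : e ∈ L) : 1 ≤ e ∧ e ≤ n := by
  have := h.mem_iff.1 he
  simp only [List.mem_map, List.mem_range] at this
  omega

theorem nodup_of_perm {L : List ℕ} (h : L.Perm ((List.range n).map (· + 1))) : L.Nodup :=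
  h.nodup_iff.2 (List.nodup_range.map fun _ _ => by simp)

/-- Membership in the part `{3, …, n-1}` of the poset, on which `d` takes values in `{n-1, n}`. -/
def IsMid (D : DyckPath n) (e : ℕ) : Prop :=
  3 ≤ e ∧ e < n ∧ (D.d e = n - 1 ∨ D.d e = n)

theorem IsMid.not_prec {D : DyckPath n} {e f : ℕ} (he : D.IsMid e) (hf : f < n) :
    ¬ D.prec e f := by
  obtain ⟨_, _, _⟩ := he
  unfold prec
  omega

theorem eq_or_isMid {D : DyckPath n}
    (hform : ∀ i : ℕ, 3 ≤ i → i < n → D.d i = n - 1 ∨ D.d i = n) {e : ℕ}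
    (he : 1 ≤ e ∧ e ≤ n) : e = 1 ∨ e = 2 ∨ D.IsMid e ∨ e = n := by
  by_cases h : 3 ≤ e ∧ e < n
  · exact .inr (.inr (.inl ⟨h.1, h.2, hform e h.1 h.2⟩))
  · omega

theorem pairInv_mid_mid {D : DyckPath n} {e f : ℕ} (he : D.IsMid e) (hf : D.IsMid f) :
    D.pairInv e f = if f < e then 1 else 0 := by
  simp [pairInv, Incomp, he.not_prec hf.2.1, hf.not_prec he.2.1]

theorem pairInv_of_le (D : DyckPath n) {e f : ℕ} (h : e ≤ f) : D.pairInv e f = 0 := by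
  simp [pairInv, h.not_gt]

theorem pairInv_of_lt (D : DyckPath n) {e f : ℕ} (hf : 1 ≤ f) (h : f < e) (he : e ≤ n) :
    D.pairInv e f = if e ≤ D.d f then 1 else 0 := by
  have := D.ge_self e (by omega) he
  simp only [pairInv, Incomp, prec]
  congr 1
  simp only [eq_iff_iff]
  omega

theorem pairInv_mid_one {D : DyckPath n} {e : ℕ} (he : D.IsMid e) :
    D.pairInv e 1 = if e ≤ D.d 1 then 1 else 0 :=
  D.pairInv_of_lt le_rfl (by have := he.1; omega) he.2.1.le

theorem pairInv_mid_two {D : DyckPath n} {e : ℕ} (he : D.IsMid e) :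
    D.pairInv e 2 = if e ≤ D.d 2 then 1 else 0 :=
  D.pairInv_of_lt one_le_two he.1 he.2.1.le

theorem pairInv_one_mid {D : DyckPath n} {e : ℕ} (he : D.IsMid e) : D.pairInv 1 e = 0 :=
  D.pairInv_of_le (by have := he.1; omega)

theorem pairInv_two_mid {D : DyckPath n} {e : ℕ} (he : D.IsMid e) : D.pairInv 2 e = 0 :=
  D.pairInv_of_le (by have := he.1; omega)

theorem pairInv_mid_top {D : DyckPath n} {e : ℕ} (he : D.IsMid e) : D.pairInv e n = 0 :=
  D.pairInv_of_le he.2.1.le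

theorem pairInv_top_mid {D : DyckPath n} {e : ℕ} (he : D.IsMid e) :
    D.pairInv n e = if n ≤ D.d e then 1 else 0 :=
  D.pairInv_of_lt (by have := he.1; omega) he.2.1 le_rfl

theorem isPTab_target_and_invNum_eq {N : ℕ} {D : DyckPath (N + 6)}
    {x y z u v w p q r s t m : ℕ} {R : List ℕ}
    (hperm : (x :: y :: z :: u :: v :: w :: R).Perm ((List.range (N + 6)).map (· + 1)))
    (hR : R.length = N) (htail : ∀ e ∈ R, D.IsMid e)
    (hsix : ∀ i, [p, q, r, s, t, m].count i = [x, y, z, u, v, w].count i)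
    (hprec : (D.prec p q ∧ D.prec r s ∧ D.prec t m) ∧
      ¬ D.prec r p ∧ ¬ D.prec s q ∧ ¬ D.prec t r ∧ ¬ D.prec m s)
    (hinv : D.pairInv p r + D.pairInv p s + D.pairInv q r + D.pairInv q s
          + D.pairInv p t + D.pairInv p m + D.pairInv q t + D.pairInv q m
          + D.pairInv r t + D.pairInv r m + D.pairInv s t + D.pairInv s m
        = D.pairInv x u + D.pairInv x v + D.pairInv y u + D.pairInv y v
          + D.pairInv z u + D.pairInv z v
          + D.pairInv x w + D.pairInv y w + D.pairInv z w + D.pairInv u w + D.pairInv v w) :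
    D.IsPTab (shape 0 3 N) (p :: q :: r :: s :: t :: m :: R) ∧
      D.invNum (shape 0 3 N) (p :: q :: r :: s :: t :: m :: R)
        = D.invNum (shape 1 1 (N + 1)) (x :: y :: z :: u :: v :: w :: R) := by
  have h6 := List.perm_iff_count.2 hsix
  obtain ⟨⟨hpq, hrs, htm⟩, hrp, hsq, htr, hms⟩ := hprec
  refine ⟨isPTab_target ((h6.append_right R).trans hperm) hR hpq hrs htm hrp hsq htr hms htm.1
    (fun e he f hf => (htail e he).not_prec hf) fun e he => (htail e he).2.1, ?_⟩
  have hcross := (h6.map (D.crossInv R)).sum_eq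
  simp only [List.map_cons, List.map_nil, List.sum_cons, List.sum_nil] at hcross
  rw [invNum_source _ _ _ _ _ _ _ _ hR, invNum_target _ _ _ _ _ _ _ _ hR, hinv]
  omega

/-- The left inverse of the injection when `2 ≤ d 1`. -/
noncomputable def unshuffleWide (D : DyckPath n) : List ℕ → List ℕ
  | p :: q :: r :: s :: t :: m :: R =>
    if D.d q < n then
      if D.d s < n then p :: q :: m :: r :: s :: t :: R
      else p :: q :: m :: r :: t :: s :: R
    else if D.d s < n then
      if p = 2 ∧ s ≤ D.d 2 then r :: s :: m :: p :: q :: t :: R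
      else p :: s :: m :: r :: q :: t :: R
    else
      if p = 2 ∧ t ≤ D.d 2 then r :: t :: m :: p :: q :: s :: R
      else p :: t :: m :: r :: q :: s :: R
  | L => L

/-- The left inverse of the injection when `d 1 = 1`. -/
noncomputable def unshuffleNarrow (D : DyckPath n) : List ℕ → List ℕ
  | o :: p :: r :: s :: t :: m :: R =>
    if r = 2 then
      if D.d 2 < p then o :: r :: p :: t :: m :: s :: R
      else if D.d p < n then o :: r :: s :: p :: m :: t :: R
      else o :: r :: s :: t :: m :: p :: R
    else
      if D.d 2 < p then o :: r :: s :: t :: p :: m :: R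
      else if D.d p < n then o :: p :: s :: t :: m :: r :: R
      else o :: r :: s :: t :: m :: p :: R
  | L => L

theorem source_cases_wide {D : DyckPath n} (h1 : 2 ≤ D.d 1) (h12 : D.d 1 ≤ D.d 2) {x y z u v : ℕ}
    (hx : x = 1 ∨ x = 2 ∨ D.IsMid x ∨ x = n) (hy : y = 1 ∨ y = 2 ∨ D.IsMid y ∨ y = n)
    (hz : 1 ≤ z ∧ z ≤ n) (hu : u = 1 ∨ u = 2 ∨ D.IsMid u ∨ u = n)
    (hv : v = 1 ∨ v = 2 ∨ D.IsMid v ∨ v = n) (hxu : x ≠ u) (hzv : z ≠ v)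
    (hxy : D.prec x y) (hyz : D.prec y z) (huv : D.prec u v) :
    (x = 1 ∧ u = 2 ∨ x = 2 ∧ u = 1) ∧ z = n ∧ D.IsMid y ∧ D.IsMid v := by
  obtain ⟨hxn, hxy⟩ := hxy
  obtain ⟨hyn, hyz⟩ := hyz
  obtain ⟨hun, huv⟩ := huv
  have hxs : x = 1 ∨ x = 2 := by
    rcases hx with h | h | ⟨_, _, _⟩ | h <;> omega
  have hy : D.IsMid y := by
    rcases hy with rfl | rfl | h | h
    · rcases hxs with rfl | rfl <;> omega
    · rcases hxs with rfl | rfl <;> omega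
    · exact h
    · omega
  have hzn : z = n := by
    obtain ⟨_, _, _⟩ := hy
    omega
  have hvn : v ≤ n := by
    rcases hv with h | h | ⟨_, _, _⟩ | h <;> omega
  have hus : u = 1 ∨ u = 2 := by
    rcases hu with h | h | ⟨_, _, _⟩ | h <;> omega
  refine ⟨by omega, hzn, hy, ?_⟩
  rcases hv with rfl | rfl | h | h
  · rcases hus with rfl | rfl <;> omega
  · rcases hus with rfl | rfl <;> omega
  · exact h
  · omega

theorem source_cases_narrow {D : DyckPath n} (h1 : D.d 1 = 1) (h2 : 2 ≤ D.d 2)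
    (hlow : ∀ e, D.IsMid e → D.d e < n → e ≤ D.d 2) {x y z u v : ℕ}
    (hx : x = 1 ∨ x = 2 ∨ D.IsMid x ∨ x = n) (hy : y = 1 ∨ y = 2 ∨ D.IsMid y ∨ y = n)
    (hz : z = 1 ∨ z = 2 ∨ D.IsMid z ∨ z = n) (hu : u = 1 ∨ u = 2 ∨ D.IsMid u ∨ u = n)
    (hv : v = 1 ∨ v = 2 ∨ D.IsMid v ∨ v = n) (hxu : x ≠ u) (hyu : y ≠ u) (hzv : z ≠ v)
    (hxy : D.prec x y) (hyz : D.prec y z) (huv : D.prec u v) :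
    x = 1 ∧ (y = 2 ∧ v = n ∧ D.IsMid z ∧ D.IsMid u ∨ z = n ∧ u = 2 ∧ D.IsMid y ∧ D.IsMid v) := by
  obtain ⟨hxn, hxy⟩ := hxy
  obtain ⟨hyn, hyz⟩ := hyz
  obtain ⟨hun, huv⟩ := huv
  have hmid : ∀ e f, D.IsMid e → D.d e < f → (f = 1 ∨ f = 2 ∨ D.IsMid f ∨ f = n) → f = n := by
    rintro e f ⟨_, _, _⟩ hf (h | h | ⟨_, _, _⟩ | h) <;> omega
  have hx1 : x = 1 := by
    rcases hx with h | rfl | h | h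
    · exact h
    · rcases hy with rfl | rfl | hy | hy
      · omega
      · omega
      · have := hmid y z hy hyz hz
        have := hlow y hy (by omega)
        omega
      · omega
    · have := hmid x y h hxy hy
      omega
    · omega
  subst hx1
  refine ⟨rfl, ?_⟩
  rcases hy with rfl | rfl | hy | hy
  · omega
  · left
    rcases hu with rfl | rfl | hu | hu
    · omega
    · omega
    · have hvn := hmid u v hu huv hv
      refine ⟨rfl, hvn, ?_, hu⟩
      rcases hz with rfl | rfl | hz | hz
      · omega
      · omega
      · exact hz
      · omega
    · omega
  · right
    have hzn := hmid y z hy hyz hz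
    rcases hu with rfl | rfl | hu | hu
    · omega
    · refine ⟨hzn, rfl, hy, ?_⟩
      rcases hv with rfl | rfl | hv | hv
      · omega
      · omega
      · exact hv
      · omega
    · have := hmid u v hu huv hv
      omega
    · omega
  · omega

set_option maxHeartbeats 1000000 in
theorem exists_target_wide {N : ℕ} {D : DyckPath (N + 6)}
    (hform : ∀ i : ℕ, 3 ≤ i → i < N + 6 → D.d i = N + 6 - 1 ∨ D.d i = N + 6)
    (h1 : 2 ≤ D.d 1) (h2 : D.d 2 < N + 6) (L : List ℕ) (hL : D.IsPTab (shape 1 1 (N + 1)) L) :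
    ∃ L', (D.IsPTab (shape 0 3 N) L' ∧
      D.invNum (shape 0 3 N) L' = D.invNum (shape 1 1 (N + 1)) L) ∧ D.unshuffleWide L' = L := by
  obtain ⟨x, y, z, u, v, w, R, rfl, hR, hxy, hyz, huv, -, -, -⟩ := exists_of_isPTab_source hL
  have hperm := hL.1
  have hcl : ∀ e ∈ x :: y :: z :: u :: v :: w :: R, e = 1 ∨ e = 2 ∨ D.IsMid e ∨ e = N + 6 :=
    fun e he => eq_or_isMid hform (mem_Icc_of_perm hperm he)
  have hnd := nodup_of_perm hperm
  have hlt : ∀ e f, D.IsMid e → D.IsMid f → D.d e < N + 6 → ¬ D.d f < N + 6 → e < f := by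
    intro e f he hf hde hdf
    by_contra! h
    have := D.mono f e (by have := hf.1; omega) h he.2.1.le
    omega
  have hge : ∀ e, D.IsMid e → N + 5 ≤ D.d e ∧ D.d e ≤ N + 6 ∧ 3 ≤ e ∧ e < N + 6 := by
    rintro e ⟨_, _, _⟩
    omega
  have hdn := D.top
  have hd12 : D.d 1 ≤ D.d 2 := D.mono 1 2 le_rfl one_le_two (by omega)
  simp only [List.nodup_cons, List.mem_cons, not_or] at hnd
  obtain ⟨hxu, hz, hy, hv⟩ := source_cases_wide h1 hd12 (hcl x (by simp)) (hcl y (by simp))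
    (mem_Icc_of_perm hperm (by simp)) (hcl u (by simp)) (hcl v (by simp)) (by tauto) (by tauto)
    hxy hyz huv
  have hmid : ∀ e ∈ x :: y :: z :: u :: v :: w :: R, e ≠ x → e ≠ u → e ≠ z → D.IsMid e := by
    intro e he _ _ _
    rcases hcl e he with h | h | h | h
    · omega
    · omega
    · exact h
    · omega
  have hw : D.IsMid w := hmid w (by simp) (by tauto) (by tauto) (by tauto)
  have htail : ∀ e ∈ R, D.IsMid e := fun e he => hmid e (by simp [he])
    (by rintro rfl; tauto) (by rintro rfl; tauto) (by rintro rfl; tauto)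
  subst hz
  have h12 : D.pairInv 1 2 = 0 := D.pairInv_of_le (by omega)
  have h1n : D.pairInv 1 (N + 6) = 0 := D.pairInv_of_le (by omega)
  have h2n : D.pairInv 2 (N + 6) = 0 := D.pairInv_of_le (by omega)
  have h21 : D.pairInv 2 1 = 1 := by
    rw [D.pairInv_of_lt le_rfl one_lt_two (by omega), if_pos (by omega)]
  have hn1 : D.pairInv (N + 6) 1 = 0 := by
    rw [D.pairInv_of_lt le_rfl (by omega) le_rfl, if_neg (by omega)]
  have hn2 : D.pairInv (N + 6) 2 = 0 := by
    rw [D.pairInv_of_lt one_le_two (by omega) le_rfl, if_neg (by omega)]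
  have hyv_ne : y ≠ v := by tauto
  have hyw_ne : y ≠ w := by tauto
  have hvw_ne : v ≠ w := by tauto
  obtain ⟨hy1, hy2, hy3, hy4⟩ := hge y hy
  obtain ⟨hv1, hv2, hv3, hv4⟩ := hge v hv
  obtain ⟨hw1, hw2, hw3, hw4⟩ := hge w hw
  unfold prec at hxy hyz huv
  clear hnd hcl hmid hL hform hge
  rcases hxu with ⟨rfl, rfl⟩ | ⟨rfl, rfl⟩
  · by_cases cv : D.d v < N + 6
    · by_cases cw : D.d w < N + 6
      · refine ⟨_, isPTab_target_and_invNum_eq hperm hR htail (p := 1) (q := y) (r := 2)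
          (s := v) (t := w) (m := N + 6) (fun i => by simp only [List.count_cons]; ring)
          (by simp only [prec]; refine ⟨⟨?_, ?_, ?_⟩, ?_, ?_, ?_, ?_⟩ <;> omega) ?_, ?_⟩
        · simp only [pairInv_mid_mid, pairInv_mid_two, pairInv_one_mid, pairInv_two_mid,
            pairInv_mid_top, pairInv_top_mid, h12, hn2, h1n, h2n, hy, hv, hw]
          split_ifs <;> omega
        · simp only [unshuffleWide]
          split_ifs <;> first | rfl | (exfalso; omega)
      · have hyw := hlt y w hy hw (by omega) cw
        have hvw := hlt v w hv hw cv cw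
        refine ⟨_, isPTab_target_and_invNum_eq hperm hR htail (p := 1) (q := y) (r := 2)
          (s := w) (t := v) (m := N + 6) (fun i => by simp only [List.count_cons]; ring)
          (by simp only [prec]; refine ⟨⟨?_, ?_, ?_⟩, ?_, ?_, ?_, ?_⟩ <;> omega) ?_, ?_⟩
        · simp only [pairInv_mid_mid, pairInv_mid_two, pairInv_one_mid, pairInv_two_mid,
            pairInv_mid_top, pairInv_top_mid, h12, hn2, h1n, h2n, hy, hv, hw]
          split_ifs <;> omega
        · simp only [unshuffleWide]
          split_ifs <;> first | rfl | (exfalso; omega)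
    · have hyv := hlt y v hy hv (by omega) cv
      by_cases cw : D.d w < N + 6
      · by_cases cy : y ≤ D.d 2
        · refine ⟨_, isPTab_target_and_invNum_eq hperm hR htail (p := 2) (q := v) (r := 1)
            (s := y) (t := w) (m := N + 6) (fun i => by simp only [List.count_cons]; ring)
            (by simp only [prec]; refine ⟨⟨?_, ?_, ?_⟩, ?_, ?_, ?_, ?_⟩ <;> omega) ?_, ?_⟩
          · simp only [pairInv_mid_mid, pairInv_mid_one, pairInv_mid_two, pairInv_one_mid,
              pairInv_two_mid, pairInv_mid_top, pairInv_top_mid, h12, h21, hn2, h1n, h2n, hy, hv,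
              hw]
            split_ifs <;> omega
          · simp only [unshuffleWide, true_and]
            split_ifs <;> first | rfl | (exfalso; omega)
        · refine ⟨_, isPTab_target_and_invNum_eq hperm hR htail (p := 1) (q := v) (r := 2)
            (s := y) (t := w) (m := N + 6) (fun i => by simp only [List.count_cons]; ring)
            (by simp only [prec]; refine ⟨⟨?_, ?_, ?_⟩, ?_, ?_, ?_, ?_⟩ <;> omega) ?_, ?_⟩
          · simp only [pairInv_mid_mid, pairInv_mid_two, pairInv_one_mid, pairInv_two_mid,
              pairInv_mid_top, pairInv_top_mid, h12, hn2, h1n, h2n, hy, hv, hw]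
            split_ifs <;> omega
          · simp only [unshuffleWide]
            split_ifs <;> first | rfl | (exfalso; omega)
      · have hyw := hlt y w hy hw (by omega) cw
        by_cases cy : y ≤ D.d 2
        · refine ⟨_, isPTab_target_and_invNum_eq hperm hR htail (p := 2) (q := v) (r := 1)
            (s := w) (t := y) (m := N + 6) (fun i => by simp only [List.count_cons]; ring)
            (by simp only [prec]; refine ⟨⟨?_, ?_, ?_⟩, ?_, ?_, ?_, ?_⟩ <;> omega) ?_, ?_⟩
          · simp only [pairInv_mid_mid, pairInv_mid_one, pairInv_mid_two, pairInv_one_mid,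
              pairInv_two_mid, pairInv_mid_top, pairInv_top_mid, h12, h21, hn2, h1n, h2n, hy, hv,
              hw]
            split_ifs <;> omega
          · simp only [unshuffleWide, true_and]
            split_ifs
            rfl
        · refine ⟨_, isPTab_target_and_invNum_eq hperm hR htail (p := 1) (q := v) (r := 2)
            (s := w) (t := y) (m := N + 6) (fun i => by simp only [List.count_cons]; ring)
            (by simp only [prec]; refine ⟨⟨?_, ?_, ?_⟩, ?_, ?_, ?_, ?_⟩ <;> omega) ?_, ?_⟩
          · simp only [pairInv_mid_mid, pairInv_mid_two, pairInv_one_mid, pairInv_two_mid,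
              pairInv_mid_top, pairInv_top_mid, h12, hn2, h1n, h2n, hy, hv, hw]
            split_ifs <;> omega
          · simp only [unshuffleWide]
            split_ifs <;> first | rfl | (exfalso; omega)
  · by_cases cv : D.d v < N + 6
    · by_cases cw : D.d w < N + 6
      · refine ⟨_, isPTab_target_and_invNum_eq hperm hR htail (p := 2) (q := y) (r := 1)
          (s := v) (t := w) (m := N + 6) (fun i => by simp only [List.count_cons]; ring)
          (by simp only [prec]; refine ⟨⟨?_, ?_, ?_⟩, ?_, ?_, ?_, ?_⟩ <;> omega) ?_, ?_⟩
        · simp only [pairInv_mid_mid, pairInv_mid_one, pairInv_one_mid, pairInv_two_mid,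
            pairInv_mid_top, pairInv_top_mid, h21, hn1, h1n, h2n, hy, hv, hw]
          split_ifs <;> omega
        · simp only [unshuffleWide]
          split_ifs <;> first | rfl | (exfalso; omega)
      · have hyw := hlt y w hy hw (by omega) cw
        have hvw := hlt v w hv hw cv cw
        refine ⟨_, isPTab_target_and_invNum_eq hperm hR htail (p := 2) (q := y) (r := 1)
          (s := w) (t := v) (m := N + 6) (fun i => by simp only [List.count_cons]; ring)
          (by simp only [prec]; refine ⟨⟨?_, ?_, ?_⟩, ?_, ?_, ?_, ?_⟩ <;> omega) ?_, ?_⟩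
        · simp only [pairInv_mid_mid, pairInv_mid_one, pairInv_one_mid, pairInv_two_mid,
            pairInv_mid_top, pairInv_top_mid, h21, hn1, h1n, h2n, hy, hv, hw]
          split_ifs <;> omega
        · simp only [unshuffleWide]
          split_ifs <;> first | rfl | (exfalso; omega)
    · have hyv := hlt y v hy hv (by omega) cv
      by_cases cw : D.d w < N + 6
      · refine ⟨_, isPTab_target_and_invNum_eq hperm hR htail (p := 2) (q := v) (r := 1)
          (s := y) (t := w) (m := N + 6) (fun i => by simp only [List.count_cons]; ring)
          (by simp only [prec]; refine ⟨⟨?_, ?_, ?_⟩, ?_, ?_, ?_, ?_⟩ <;> omega) ?_, ?_⟩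
        · simp only [pairInv_mid_mid, pairInv_mid_one, pairInv_one_mid, pairInv_two_mid,
            pairInv_mid_top, pairInv_top_mid, h21, hn1, h1n, h2n, hy, hv, hw]
          split_ifs <;> omega
        · simp only [unshuffleWide]
          split_ifs <;> first | rfl | (exfalso; omega)
      · have hyw := hlt y w hy hw (by omega) cw
        refine ⟨_, isPTab_target_and_invNum_eq hperm hR htail (p := 2) (q := v) (r := 1)
          (s := w) (t := y) (m := N + 6) (fun i => by simp only [List.count_cons]; ring)
          (by simp only [prec]; refine ⟨⟨?_, ?_, ?_⟩, ?_, ?_, ?_, ?_⟩ <;> omega) ?_, ?_⟩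
        · simp only [pairInv_mid_mid, pairInv_mid_one, pairInv_one_mid, pairInv_two_mid,
            pairInv_mid_top, pairInv_top_mid, h21, hn1, h1n, h2n, hy, hv, hw]
          split_ifs <;> omega
        · simp only [unshuffleWide]
          split_ifs <;> first | rfl | (exfalso; omega)

set_option maxHeartbeats 1000000 in
theorem exists_target_narrow {N : ℕ} {D : DyckPath (N + 6)}
    (hform : ∀ i : ℕ, 3 ≤ i → i < N + 6 → D.d i = N + 6 - 1 ∨ D.d i = N + 6)
    (h1 : D.d 1 = 1) (h2 : D.d 2 < N + 6) (hb : D.d (D.d 2 + 1) = N + 6)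
    (L : List ℕ) (hL : D.IsPTab (shape 1 1 (N + 1)) L) :
    ∃ L', (D.IsPTab (shape 0 3 N) L' ∧
      D.invNum (shape 0 3 N) L' = D.invNum (shape 1 1 (N + 1)) L) ∧ D.unshuffleNarrow L' = L := by
  obtain ⟨x, y, z, u, v, w, R, rfl, hR, hxy, hyz, huv, -, -, -⟩ := exists_of_isPTab_source hL
  have hperm := hL.1
  have hcl : ∀ e ∈ x :: y :: z :: u :: v :: w :: R, e = 1 ∨ e = 2 ∨ D.IsMid e ∨ e = N + 6 :=
    fun e he => eq_or_isMid hform (mem_Icc_of_perm hperm he)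
  have hnd := nodup_of_perm hperm
  have hlt : ∀ e f, D.IsMid e → D.IsMid f → D.d e < N + 6 → ¬ D.d f < N + 6 → e < f := by
    intro e f he hf hde hdf
    by_contra! h
    have := D.mono f e (by have := hf.1; omega) h he.2.1.le
    omega
  have hge : ∀ e, D.IsMid e → N + 5 ≤ D.d e ∧ D.d e ≤ N + 6 ∧ 3 ≤ e ∧ e < N + 6 := by
    rintro e ⟨_, _, _⟩
    omega
  have hdn := D.top
  have hd2 : 2 ≤ D.d 2 := D.ge_self 2 one_le_two (by omega)
  have hlow : ∀ e, D.IsMid e → D.d e < N + 6 → e ≤ D.d 2 := by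
    intro e he hde
    by_contra hlt
    have := D.mono (D.d 2 + 1) e (by omega) (by omega) he.2.1.le
    omega
  simp only [List.nodup_cons, List.mem_cons, not_or] at hnd
  obtain ⟨rfl, hcase⟩ := source_cases_narrow h1 hd2 hlow (hcl x (by simp)) (hcl y (by simp))
    (hcl z (by simp)) (hcl u (by simp)) (hcl v (by simp)) (by tauto) (by tauto) (by tauto)
    hxy hyz huv
  have hmid : ∀ e ∈ 1 :: y :: z :: u :: v :: w :: R, e ≠ 1 → e ≠ 2 → e ≠ N + 6 → D.IsMid e := by
    intro e he _ _ _
    rcases hcl e he with h | h | h | h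
    · omega
    · omega
    · exact h
    · omega
  have hw : D.IsMid w := by
    refine hmid w (by simp) (by tauto) ?_ ?_ <;> rintro rfl <;>
      rcases hcase with ⟨rfl, rfl, -⟩ | ⟨rfl, rfl, -⟩ <;> tauto
  have htail : ∀ e ∈ R, D.IsMid e := by
    intro e he
    refine hmid e (by simp [he]) ?_ ?_ ?_ <;> rintro rfl <;>
      rcases hcase with ⟨rfl, rfl, -⟩ | ⟨rfl, rfl, -⟩ <;> tauto
  have h12 : D.pairInv 1 2 = 0 := D.pairInv_of_le (by omega)
  have h1n : D.pairInv 1 (N + 6) = 0 := D.pairInv_of_le (by omega)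
  have h2n : D.pairInv 2 (N + 6) = 0 := D.pairInv_of_le (by omega)
  have h21 : D.pairInv 2 1 = 0 := by
    rw [D.pairInv_of_lt le_rfl one_lt_two (by omega), if_neg (by omega)]
  have hn1 : D.pairInv (N + 6) 1 = 0 := by
    rw [D.pairInv_of_lt le_rfl (by omega) le_rfl, if_neg (by omega)]
  have hn2 : D.pairInv (N + 6) 2 = 0 := by
    rw [D.pairInv_of_lt one_le_two (by omega) le_rfl, if_neg (by omega)]
  rcases hcase with ⟨rfl, rfl, hz, hu⟩ | ⟨rfl, rfl, hy, hv⟩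
  · have hzu_ne : z ≠ u := by tauto
    have hzw_ne : z ≠ w := by tauto
    have huw_ne : u ≠ w := by tauto
    have hlz := hlow z hz
    obtain ⟨hz1, hz2, hz3, hz4⟩ := hge z hz
    have hlu := hlow u hu
    obtain ⟨hu1, hu2, hu3, hu4⟩ := hge u hu
    have hlw := hlow w hw
    obtain ⟨hw1, hw2, hw3, hw4⟩ := hge w hw
    unfold prec at hxy hyz huv
    clear hnd hcl hmid hL hform hge hlow
    by_cases cb : D.d 2 < w
    · refine ⟨_, isPTab_target_and_invNum_eq hperm hR htail (p := 1) (q := z) (r := 2)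
        (s := w) (t := u) (m := N + 6) (fun i => by simp only [List.count_cons]; ring)
        (by simp only [prec]; refine ⟨⟨?_, ?_, ?_⟩, ?_, ?_, ?_, ?_⟩ <;> omega) ?_, ?_⟩
      · simp only [pairInv_mid_mid, pairInv_mid_two, pairInv_one_mid, pairInv_two_mid,
          pairInv_mid_top, pairInv_top_mid, h12, h1n, h2n, hz, hu, hw]
        split_ifs <;> omega
      · simp only [unshuffleNarrow]
        split_ifs <;> first | rfl | (exfalso; omega)
    · by_cases cw : D.d w < N + 6
      · refine ⟨_, isPTab_target_and_invNum_eq hperm hR htail (p := 1) (q := u) (r := 2)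
          (s := z) (t := w) (m := N + 6) (fun i => by simp only [List.count_cons]; ring)
          (by simp only [prec]; refine ⟨⟨?_, ?_, ?_⟩, ?_, ?_, ?_, ?_⟩ <;> omega) ?_, ?_⟩
        · simp only [pairInv_mid_mid, pairInv_mid_two, pairInv_one_mid, pairInv_two_mid,
            pairInv_mid_top, pairInv_top_mid, h12, h1n, h2n, hz, hu, hw]
          split_ifs <;> omega
        · simp only [unshuffleNarrow]
          split_ifs <;> first | rfl | (exfalso; omega)
      · have huw := hlt u w hu hw (by omega) cw
        refine ⟨_, isPTab_target_and_invNum_eq hperm hR htail (p := 1) (q := w) (r := 2)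
          (s := z) (t := u) (m := N + 6) (fun i => by simp only [List.count_cons]; ring)
          (by simp only [prec]; refine ⟨⟨?_, ?_, ?_⟩, ?_, ?_, ?_, ?_⟩ <;> omega) ?_, ?_⟩
        · simp only [pairInv_mid_mid, pairInv_mid_two, pairInv_one_mid, pairInv_two_mid,
            pairInv_mid_top, pairInv_top_mid, h12, h1n, h2n, hz, hu, hw]
          split_ifs <;> omega
        · simp only [unshuffleNarrow]
          split_ifs <;> rfl
  · have hyv_ne : y ≠ v := by tauto
    have hyw_ne : y ≠ w := by tauto
    have hvw_ne : v ≠ w := by tauto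
    have hly := hlow y hy
    obtain ⟨hy1, hy2, hy3, hy4⟩ := hge y hy
    have hlv := hlow v hv
    obtain ⟨hv1, hv2, hv3, hv4⟩ := hge v hv
    have hlw := hlow w hw
    obtain ⟨hw1, hw2, hw3, hw4⟩ := hge w hw
    unfold prec at hxy hyz huv
    clear hnd hcl hmid hL hform hge hlow
    by_cases cb : D.d 2 < w
    · refine ⟨_, isPTab_target_and_invNum_eq hperm hR htail (p := 1) (q := v) (r := y)
        (s := (N + 6)) (t := 2) (m := w) (fun i => by simp only [List.count_cons]; ring)
        (by simp only [prec]; refine ⟨⟨?_, ?_, ?_⟩, ?_, ?_, ?_, ?_⟩ <;> omega) ?_, ?_⟩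
      · simp only [pairInv_mid_mid, pairInv_mid_two, pairInv_one_mid, pairInv_two_mid,
          pairInv_mid_top, pairInv_top_mid, h12, hn2, h1n, hy, hv, hw]
        split_ifs <;> omega
      · simp only [unshuffleNarrow]
        split_ifs <;> first | rfl | (exfalso; omega)
    · by_cases cw : D.d w < N + 6
      · refine ⟨_, isPTab_target_and_invNum_eq hperm hR htail (p := 1) (q := y) (r := w)
          (s := (N + 6)) (t := 2) (m := v) (fun i => by simp only [List.count_cons]; ring)
          (by simp only [prec]; refine ⟨⟨?_, ?_, ?_⟩, ?_, ?_, ?_, ?_⟩ <;> omega) ?_, ?_⟩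
        · simp only [pairInv_mid_mid, pairInv_mid_two, pairInv_one_mid,
            pairInv_two_mid, pairInv_mid_top, pairInv_top_mid, h12, hn2, h1n, hy, hv,
            hw]
          split_ifs <;> omega
        · simp only [unshuffleNarrow]
          split_ifs <;> first | rfl | (exfalso; omega)
      · have hyw := hlt y w hy hw (by omega) cw
        refine ⟨_, isPTab_target_and_invNum_eq hperm hR htail (p := 1) (q := w) (r := y)
          (s := (N + 6)) (t := 2) (m := v) (fun i => by simp only [List.count_cons]; ring)
          (by simp only [prec]; refine ⟨⟨?_, ?_, ?_⟩, ?_, ?_, ?_, ?_⟩ <;> omega) ?_, ?_⟩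
        · simp only [pairInv_mid_mid, pairInv_mid_two, pairInv_one_mid,
            pairInv_two_mid, pairInv_mid_top, pairInv_top_mid, h12, hn2, h1n, hy, hv,
            hw]
          split_ifs <;> omega
        · simp only [unshuffleNarrow]
          split_ifs <;> rfl

end DyckPath

/-- For a Dyck path `d = (d₁, d₂, n-1, …, n-1, n, …, n)` of bounce number
three with `n ≥ 6`, there is an inversion-preserving injection `ψ` from the `P`-tableaux of
shape `3 2 1^{n-5}` into those of shape `2^3 1^{n-6}`. -/
theorem exists_injection_psi
    (n : ℕ) (D : DyckPath n) (hn : 6 ≤ n)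
    (hform : ∀ i : ℕ, 3 ≤ i → i < n → D.d i = n - 1 ∨ D.d i = n)
    (h3 : D.BounceThree) :
    ∃ ψ : {L : List ℕ // D.IsPTab (shape 1 1 (n - 5)) L} →
        {L : List ℕ // D.IsPTab (shape 0 3 (n - 6)) L},
      Function.Injective ψ ∧
      ∀ T, D.invNum (shape 0 3 (n - 6)) (ψ T).1 = D.invNum (shape 1 1 (n - 5)) T.1 := by
  obtain ⟨N, rfl⟩ := Nat.exists_eq_add_of_le' hn
  obtain ⟨hm0, hm1, hm2⟩ := h3
  simp only [DyckPath.m0, DyckPath.m1, DyckPath.bounce] at hm0 hm1 hm2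
  have hd1 := D.ge_self 1 le_rfl (by omega)
  obtain ⟨g, hg⟩ : ∃ g : List ℕ → List ℕ, ∀ L, D.IsPTab (shape 1 1 (N + 1)) L →
      ∃ L', (D.IsPTab (shape 0 3 N) L' ∧
        D.invNum (shape 0 3 N) L' = D.invNum (shape 1 1 (N + 1)) L) ∧ g L' = L := by
    by_cases h1 : D.d 1 = 1
    · rw [h1] at hm1 hm2
      exact ⟨_, DyckPath.exists_target_narrow hform h1 hm1 hm2⟩
    · exact ⟨_, DyckPath.exists_target_wide hform (by omega)
        ((D.mono 2 (D.d 1 + 1) one_le_two (by omega) (by omega)).trans_lt hm1)⟩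
  choose f hf hgf using hg
  refine ⟨fun T => ⟨f T.1 T.2, (hf T.1 T.2).1⟩, fun T₁ T₂ h => Subtype.ext ?_,
    fun T => (hf T.1 T.2).2⟩
  rw [← hgf T₁.1 T₁.2, ← hgf T₂.1 T₂.2]
  exact congrArg (fun T => g T.1) h
end
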